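/- Let n ≥ 2 be an integer. Let S be the 2n×2n block matrix [[0, I_n], [I_n, 0]], let G = {A ∈ GL(2n, ℂ) : Aᵀ S A = S and det A = 1} (a copy of SO(2n, ℂ)), let J = diag(I_n, -I_n), and let H = {A ∈ G : A* J A = J} (the standard realization of the real form SO*(2n) = SO(2n,ℂ) ∩ SU(n,n)). Then there is no discrete subgroup Γ of G acting properly discontinuously and cocompactly on the homogeneous space G/H; that is, SO(2n,ℂ)/SO*(2n) admits no compact Clifford–Klein form. -/

import Mathlib

/-!
The homogeneous space `SO(2n,ℂ)/SO*(2n)` admits no compact Clifford–Klein form.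
-/

open Matrix

set_option maxHeartbeats 1000000
set_option synthInstance.maxHeartbeats 1000000

noncomputable section

/-- The symmetric matrix `S = [[0, I_n], [I_n, 0]]`. -/
def Smat (n : ℕ) : Matrix (Fin n ⊕ Fin n) (Fin n ⊕ Fin n) ℂ :=
  Matrix.fromBlocks 0 1 1 0

/-- A copy of the complex special orthogonal group `SO(2n, ℂ)`: the subgroup of
`GL(2n, ℂ)` of matrices `A` with `Aᵀ S A = S` and `det A = 1`, where
`S = [[0, I_n], [I_n, 0]]`. -/
def SOevenC (n : ℕ) : Subgroup (GL (Fin n ⊕ Fin n) ℂ) where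
  carrier := {A | A.valᵀ * Smat n * A.val = Smat n ∧ A.val.det = 1}
  one_mem' := by constructor <;> simp
  mul_mem' := by
    rintro A B ⟨hA1, hA2⟩ ⟨hB1, hB2⟩
    constructor
    · have key : (A * B).valᵀ * Smat n * (A * B).val =
          B.valᵀ * (A.valᵀ * Smat n * A.val) * B.val := by
        rw [Units.val_mul, transpose_mul]
        simp only [Matrix.mul_assoc]
      rw [key, hA1]
      exact hB1
    · rw [Units.val_mul, det_mul, hA2, hB2, mul_one]
  inv_mem' := by
    rintro A ⟨hA1, hA2⟩
    constructor
    · calc (A⁻¹).valᵀ * Smat n * (A⁻¹).val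
          = (A⁻¹).valᵀ * (A.valᵀ * Smat n * A.val) * (A⁻¹).val := by rw [hA1]
        _ = (A.val * (A⁻¹).val)ᵀ * Smat n * (A.val * (A⁻¹).val) := by
            rw [transpose_mul]
            simp only [Matrix.mul_assoc]
        _ = Smat n := by rw [Units.mul_inv]; simp
    · have h := congrArg Matrix.det (Units.mul_inv A)
      rw [det_mul, hA2, one_mul] at h
      simpa using h

/-- The matrix `J = diag(I_n, -I_n)`. -/
def Jnn (n : ℕ) : Matrix (Fin n ⊕ Fin n) (Fin n ⊕ Fin n) ℂ :=
  Matrix.diagonal (Sum.elim (fun _ => 1) (fun _ => -1))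

/-- The group `SO*(2n) = SO(2n,ℂ) ∩ SU(n,n)`, realized as the subgroup of `SO(2n,ℂ)` of
matrices `A` with `A* J A = J`, where `A*` is the conjugate transpose and
`J = diag(I_n, -I_n)`. -/
def SOstar (n : ℕ) : Subgroup ↥(SOevenC n) where
  carrier := {A | A.val.valᴴ * Jnn n * A.val.val = Jnn n}
  one_mem' := by
    show (1 : Matrix (Fin n ⊕ Fin n) (Fin n ⊕ Fin n) ℂ)ᴴ * Jnn n * 1 = Jnn n
    simp
  mul_mem' := by
    intro A B hA hB
    show (A * B).val.valᴴ * Jnn n * (A * B).val.val = Jnn n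
    have h : (A * B).val.val = A.val.val * B.val.val := rfl
    have key : (A.val.val * B.val.val)ᴴ * Jnn n * (A.val.val * B.val.val) =
        B.val.valᴴ * (A.val.valᴴ * Jnn n * A.val.val) * B.val.val := by
      rw [conjTranspose_mul]
      simp only [Matrix.mul_assoc]
    rw [h, key, hA]
    exact hB
  inv_mem' := by
    intro A hA
    show (A⁻¹).val.valᴴ * Jnn n * (A⁻¹).val.val = Jnn n
    have hAinv : A.val.val * (A⁻¹).val.val = 1 := by
      have h : (A⁻¹).val = (A.val)⁻¹ := rfl
      rw [h]; exact Units.mul_inv A.val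
    calc (A⁻¹).val.valᴴ * Jnn n * (A⁻¹).val.val
        = (A⁻¹).val.valᴴ * (A.val.valᴴ * Jnn n * A.val.val) * (A⁻¹).val.val := by rw [hA]
      _ = (A.val.val * (A⁻¹).val.val)ᴴ * Jnn n * (A.val.val * (A⁻¹).val.val) := by
          rw [conjTranspose_mul]
          simp only [Matrix.mul_assoc]
      _ = Jnn n := by rw [hAinv]; simp

section Helpers

open Topology MeasureTheory

/-- The determinant as a continuous multilinear function of the rows. -/
def detRowCM (ι : Type) [Fintype ι] [DecidableEq ι] :
    ContinuousMultilinearMap ℝ (fun _ : ι => ι → ℝ) ℝ where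
  toMultilinearMap := (Matrix.detRowAlternating (n := ι) (R := ℝ)).toMultilinearMap
  cont := by
    change Continuous fun v : ι → ι → ℝ => Matrix.det v
    exact Continuous.matrix_det (A := fun v : ι → ι → ℝ => (v : Matrix ι ι ℝ)) continuous_id

lemma detRowCM_apply {ι : Type} [Fintype ι] [DecidableEq ι] (v : ι → ι → ℝ) :
    detRowCM ι v = Matrix.det (Matrix.of v) := rfl

lemma HasDerivAt.detRowCM {ι : Type} [Fintype ι] [DecidableEq ι] {A : ℝ → ι → ι → ℝ}
    {A' : ι → ι → ℝ} {t : ℝ} (h : ∀ a, HasDerivAt (fun s => A s a) (A' a) t) :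
    HasDerivAt (fun s => detRowCM ι (A s))
      (∑ a, detRowCM ι (Function.update (A t) a (A' a))) t := by
  have h1 : HasDerivAt A A' t := hasDerivAt_pi.2 h
  have h2 := ((_root_.detRowCM ι).hasFDerivAt (A t)).comp_hasDerivAt t h1
  rw [ContinuousMultilinearMap.linearDeriv_apply] at h2
  exact h2

lemma detRowCM_swap_update {ι : Type} [Fintype ι] [DecidableEq ι] (v : ι → ι → ℝ)
    {a b : ι} (hab : a ≠ b) (x y : ι → ℝ) :
    detRowCM ι (Function.update (Function.update v a x) b y) =
      - detRowCM ι (Function.update (Function.update v a y) b x) := by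
  have h := (Matrix.detRowAlternating (n := ι) (R := ℝ)).map_swap
    (Function.update (Function.update v a y) b x) hab
  have h2 : (Function.update (Function.update v a y) b x) ∘ Equiv.swap a b =
      Function.update (Function.update v a x) b y := by
    ext i
    by_cases hi : i = a
    · subst hi; simp [hab]
    · by_cases hi' : i = b
      · subst hi'; simp [hab]
      · simp [Equiv.swap_apply_of_ne_of_ne hi hi', hi, hi']
  rw [h2] at h
  exact h

lemma sum_detRowCM_update_smul {ι : Type} [Fintype ι] [DecidableEq ι] (A : ι → ι → ℝ)
    (w : ι → ℝ) :
    ∑ a, detRowCM ι (Function.update A a w) • A a = detRowCM ι A • w := by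
  have h := Matrix.mulVec_cramer (Matrix.of A)ᵀ w
  rw [Matrix.det_transpose] at h
  rw [detRowCM_apply, ← h]
  ext i
  simp only [Finset.sum_apply, Pi.smul_apply, smul_eq_mul, Matrix.mulVec, dotProduct,
    Matrix.transpose_apply, Matrix.of_apply, Matrix.cramer_transpose_apply]
  refine Finset.sum_congr rfl fun a _ => ?_
  rw [mul_comm, detRowCM_apply]
  rfl

/-- The pointwise divergence identity behind the homotopy invariance of the degree. -/
lemma sum_divergence_eq {ι : Type} [Fintype ι] [DecidableEq ι] (A : ι → ι → ℝ)
    (w : ι → ℝ) (w' : ι → ι → ℝ) (D : ι → ι → ι → ℝ) (c : ℝ) (χ' : (ι → ℝ) →L[ℝ] ℝ)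
    (hD : ∀ a b, a ≠ b →
      detRowCM ι (Function.update (Function.update A a w) b (D a b - D b a)) = 0) :
    ∑ a, (χ' (A a) * detRowCM ι (Function.update A a w) +
      c * ∑ b, detRowCM ι (Function.update (Function.update A a w) b
        (if b = a then w' a else D a b))) =
    χ' w * detRowCM ι A + c * ∑ a, detRowCM ι (Function.update A a (w' a)) := by
  rw [Finset.sum_add_distrib, ← Finset.mul_sum]
  congr 1
  · have := congrArg χ' (sum_detRowCM_update_smul A w)
    simp only [map_sum, map_smul, smul_eq_mul] at this
    rw [mul_comm (χ' w), ← this]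
    exact Finset.sum_congr rfl fun a _ => mul_comm _ _
  · congr 1
    have h0 : ∀ a b, detRowCM ι (Function.update (Function.update A a w) b
        (if b = a then w' a else D a b)) =
        (if a = b then detRowCM ι (Function.update A a (w' a)) else 0) +
        (if a = b then 0 else
          detRowCM ι (Function.update (Function.update A a w) b (D a b))) := by
      intro a b
      by_cases hab : a = b
      · subst hab; simp
      · simp [hab, Ne.symm hab]
    simp only [h0, Finset.sum_add_distrib]
    have h1 : ∀ S : ℝ, S = -S → S = 0 := fun S hS => by linarith
    have h2 : (∑ a, ∑ b, if a = b then 0 else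
        detRowCM ι (Function.update (Function.update A a w) b (D a b))) = 0 := by
      apply h1
      conv_rhs => rw [Finset.sum_comm]
      rw [← Finset.sum_neg_distrib]
      refine Finset.sum_congr rfl fun a _ => ?_
      rw [← Finset.sum_neg_distrib]
      refine Finset.sum_congr rfl fun b _ => ?_
      by_cases hab : a = b
      · simp [hab]
      · simp only [hab, Ne.symm hab, if_false]
        have h3 := hD a b hab
        rw [ContinuousMultilinearMap.map_update_sub] at h3
        have h5 : Function.update (Function.update A b w) a (D b a) =
            Function.update (Function.update A a (D b a)) b w :=
          Function.update_comm (Ne.symm hab) w (D b a) A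
        rw [h5, detRowCM_swap_update A hab (D b a) w, neg_neg]
        linarith
    rw [h2, add_zero]
    simp

lemma hasDerivAt_integral_of_compact {Y : Type} [TopologicalSpace Y] [T2Space Y]
    [MeasurableSpace Y] [BorelSpace Y] (μ : Measure Y) [IsFiniteMeasureOnCompacts μ]
    {F F' : ℝ → Y → ℝ} (hF : Continuous fun p : ℝ × Y => F p.1 p.2)
    (hF' : Continuous fun p : ℝ × Y => F' p.1 p.2)
    (hd : ∀ t y, HasDerivAt (fun s => F s y) (F' t y) t)
    {C : Set Y} (hC : IsCompact C) {t₀ : ℝ}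
    (hsupp : ∀ t, |t - t₀| < 1 → ∀ y ∉ C, F t y = 0) :
    HasDerivAt (fun t => ∫ y, F t y ∂μ) (∫ y, F' t₀ y ∂μ) t₀ := by
  have hFt : ∀ t, Continuous (F t) := fun t => hF.comp (by fun_prop : Continuous fun y => (t, y))
  have hFt' : ∀ t, Continuous (F' t) := fun t =>
    hF'.comp (by fun_prop : Continuous fun y => (t, y))
  have hCm : MeasurableSet C := hC.measurableSet
  have meas : ∀ (f : Y → ℝ), Continuous f → (∀ y ∉ C, f y = 0) → Integrable f μ := by
    intro f hf h0
    have h1 : HasCompactSupport f := HasCompactSupport.intro hC h0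
    exact hf.integrable_of_hasCompactSupport h1
  have hs : Metric.ball t₀ 1 ∈ 𝓝 t₀ := Metric.ball_mem_nhds _ one_pos
  have hsupp' : ∀ t ∈ Metric.ball t₀ 1, ∀ y ∉ C, F' t y = 0 := by
    intro t ht y hy
    have h1 : (fun s => F s y) =ᶠ[𝓝 t] fun _ => 0 := by
      filter_upwards [Metric.isOpen_ball.mem_nhds ht] with s hs
      exact hsupp s (by simpa [Real.dist_eq] using hs) y hy
    have := (hd t y).congr_of_eventuallyEq h1.symm
    exact this.unique (hasDerivAt_const t 0)
  obtain ⟨M, hM⟩ := ((isCompact_closedBall t₀ 1).prod hC).exists_bound_of_continuousOn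
    hF'.continuousOn
  have key := hasDerivAt_integral_of_dominated_loc_of_deriv_le (μ := μ) (F := F) (F' := F')
    (x₀ := t₀) (s := Metric.ball t₀ 1) (bound := C.indicator fun _ => M) hs ?_ ?_ ?_ ?_ ?_ ?_
  · exact key.2
  · filter_upwards [hs] with t ht
    exact (meas _ (hFt t) (hsupp t (by simpa [Real.dist_eq] using ht))).aestronglyMeasurable
  · exact meas _ (hFt _) (hsupp _ (by simp))
  · exact (meas _ (hFt' _) (hsupp' _ (by simp))).aestronglyMeasurable
  · refine Filter.Eventually.of_forall fun y t ht => ?_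
    by_cases hy : y ∈ C
    · rw [Set.indicator_of_mem hy]
      exact hM (t, y) ⟨Metric.ball_subset_closedBall ht, hy⟩
    · rw [Set.indicator_of_notMem hy, hsupp' t ht y hy, norm_zero]
  · rw [integrable_indicator_iff hCm]
    exact integrableOn_const hC.measure_lt_top.ne
  · exact Filter.Eventually.of_forall fun y t _ => hd t y

lemma integral_flow_deriv_eq_zero {Y : Type} [TopologicalSpace Y] [T2Space Y]
    [MeasurableSpace Y] [BorelSpace Y] (μ : Measure Y) [IsFiniteMeasureOnCompacts μ]
    (φ : ℝ → Y → Y) (hφ : Continuous fun p : ℝ × Y => φ p.1 p.2)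
    (hφ0 : ∀ y, φ 0 y = y) (hφadd : ∀ s t y, φ s (φ t y) = φ (s + t) y)
    (hmp : ∀ t, MeasurePreserving (φ t) μ μ) {f f' : Y → ℝ} (hf : Continuous f)
    (hf' : Continuous f') (hd : ∀ y, HasDerivAt (fun t => f (φ t y)) (f' y) 0)
    {C : Set Y} (hC : IsCompact C) (hsupp : ∀ y ∉ C, f y = 0) :
    ∫ y, f' y ∂μ = 0 := by
  have hC' : IsCompact ((fun p : ℝ × Y => φ p.1 p.2) '' (Metric.closedBall 0 1 ×ˢ C)) :=
    ((isCompact_closedBall 0 1).prod hC).image hφ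
  have key := hasDerivAt_integral_of_compact μ (F := fun t y => f (φ t y))
    (F' := fun t y => f' (φ t y)) (hf.comp hφ) (hf'.comp hφ) ?_ hC' (t₀ := 0) ?_
  · have h1 : (fun t => ∫ y, f (φ t y) ∂μ) = fun _ => ∫ y, f y ∂μ := by
      funext t
      have hφt : ∀ t, Continuous (φ t) := fun t =>
        hφ.comp (by fun_prop : Continuous fun y => (t, y))
      have hemb : MeasurableEmbedding (φ t) := by
        refine Topology.IsClosedEmbedding.measurableEmbedding ?_
        exact Homeomorph.isClosedEmbedding
          { toFun := φ t
            invFun := φ (-t)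
            left_inv := fun y => by rw [hφadd]; simp [hφ0]
            right_inv := fun y => by rw [hφadd]; simp [hφ0]
            continuous_toFun := hφt t
            continuous_invFun := hφt (-t) }
      exact (hmp t).integral_comp hemb f
    rw [h1] at key
    simpa [hφ0] using key.unique (hasDerivAt_const _ _)
  · intro t y
    have h := hd (φ t y)
    have h2 : HasDerivAt (fun s : ℝ => s - t) 1 t := (hasDerivAt_id t).sub_const t
    have h3 : HasDerivAt (fun s => f (φ s (φ t y))) (f' (φ t y)) (t - t) := by simpa using h
    have h4 := HasDerivAt.comp (h₂ := fun s => f (φ s (φ t y))) (h := fun s : ℝ => s - t) t h3 h2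
    simp only [mul_one] at h4
    refine h4.congr_of_eventuallyEq (Filter.Eventually.of_forall fun s => ?_)
    simp [hφadd]
  · intro t ht y hy
    apply hsupp
    intro hmem
    apply hy
    refine ⟨(-t, φ t y), ⟨?_, hmem⟩, ?_⟩
    · simpa using le_of_lt ht
    · simp [hφadd, hφ0]

/-- Homotopy invariance of the degree integral attached to a frame of measure preserving flows. -/
lemma degree_integral_const {Y : Type} [TopologicalSpace Y] [T2Space Y]
    [MeasurableSpace Y] [BorelSpace Y] (μ : Measure Y) [IsFiniteMeasureOnCompacts μ]
    {ι : Type} [Fintype ι] [DecidableEq ι]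
    (φ : ι → ℝ → Y → Y) (hφ : ∀ a, Continuous fun p : ℝ × Y => φ a p.1 p.2)
    (hφ0 : ∀ a y, φ a 0 y = y) (hφadd : ∀ a s t y, φ a s (φ a t y) = φ a (s + t) y)
    (hmp : ∀ a t, MeasurePreserving (φ a t) μ μ)
    {Ψ β : Y → ι → ℝ} {A B : ι → Y → ι → ℝ} {P Q : ι → ι → Y → ι → ℝ}
    (cΨ : Continuous Ψ) (cβ : Continuous β) (cA : ∀ a, Continuous (A a))
    (cB : ∀ a, Continuous (B a)) (cP : ∀ a b, Continuous (P a b)) (cQ : ∀ a b, Continuous (Q a b))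
    (dΨ : ∀ a y, HasDerivAt (fun t => Ψ (φ a t y)) (A a y) 0)
    (dβ : ∀ a y, HasDerivAt (fun t => β (φ a t y)) (B a y) 0)
    (dA : ∀ a b y, HasDerivAt (fun t => A b (φ a t y)) (P a b y) 0)
    (dB : ∀ a b y, HasDerivAt (fun t => B b (φ a t y)) (Q a b y) 0)
    (hanti : ∀ y (τ : ℝ) a b, a ≠ b → detRowCM ι (Function.update (Function.update
      (fun c => A c y + τ • B c y) a (β y)) b
        ((P a b y + τ • Q a b y) - (P b a y + τ • Q b a y))) = 0)
    {χ : (ι → ℝ) → ℝ} (hχ : ContDiff ℝ 1 χ)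
    (hsupp : ∀ τ₀ : ℝ, ∃ C : Set Y, IsCompact C ∧ ∀ τ, |τ - τ₀| < 1 → ∀ y ∉ C,
      χ (Ψ y + τ • β y) = 0) (τ : ℝ) :
    ∫ y, χ (Ψ y + τ • β y) * detRowCM ι (fun c => A c y + τ • B c y) ∂μ =
      ∫ y, χ (Ψ y) * detRowCM ι (fun c => A c y) ∂μ := by
  have cχ := hχ.continuous
  have cχ' : Continuous (fderiv ℝ χ) := hχ.continuous_fderiv one_ne_zero
  have cd := (detRowCM ι).cont
  have cdet : Continuous fun v : ι → ι → ℝ => detRowCM ι v := cd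
  set F : ℝ → Y → ℝ := fun τ y =>
    χ (Ψ y + τ • β y) * detRowCM ι (fun c => A c y + τ • B c y) with hF
  set F' : ℝ → Y → ℝ := fun τ y =>
    fderiv ℝ χ (Ψ y + τ • β y) (β y) * detRowCM ι (fun c => A c y + τ • B c y) +
    χ (Ψ y + τ • β y) *
      ∑ a, detRowCM ι (Function.update (fun c => A c y + τ • B c y) a (B a y)) with hF'
  have dF : ∀ τ, HasDerivAt (fun τ => ∫ y, F τ y ∂μ) (∫ y, F' τ y ∂μ) τ := by
    intro τ₀
    obtain ⟨C, hC, hC0⟩ := hsupp τ₀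
    refine hasDerivAt_integral_of_compact μ ?_ ?_ ?_ hC (t₀ := τ₀) ?_
    · simp only [hF]
      fun_prop
    · simp only [hF']
      have : ∀ a, Continuous fun p : ℝ × Y => detRowCM ι
          (Function.update (fun c => A c p.2 + p.1 • B c p.2) a (B a p.2)) := by
        intro a
        refine cdet.comp ?_
        refine Continuous.update ?_ _ ?_ <;> fun_prop
      fun_prop
    · intro t y
      simp only [hF, hF']
      have d1 : HasDerivAt (fun t : ℝ => Ψ y + t • β y) (β y) t := by
        simpa using ((hasDerivAt_id t).smul_const (β y)).const_add (Ψ y)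
      have d2 : HasDerivAt (fun t : ℝ => χ (Ψ y + t • β y))
          (fderiv ℝ χ (Ψ y + t • β y) (β y)) t :=
        ((hχ.differentiable one_ne_zero).differentiableAt.hasFDerivAt).comp_hasDerivAt t d1
      have d3 : HasDerivAt (fun t : ℝ => detRowCM ι (fun c => A c y + t • B c y))
          (∑ a, detRowCM ι (Function.update (fun c => A c y + t • B c y) a (B a y))) t := by
        refine HasDerivAt.detRowCM (A := fun t c => A c y + t • B c y) fun a => ?_
        simpa using ((hasDerivAt_id t).smul_const (B a y)).const_add (A a y)
      exact d2.mul d3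
    · intro t ht y hy
      simp only [hF, hC0 t ht y hy, zero_mul]
  have hzero : ∀ τ, ∫ y, F' τ y ∂μ = 0 := by
    intro τ
    obtain ⟨C, hC, hC0⟩ := hsupp τ
    have hC0 := hC0 τ (by simp)
    set At : Y → ι → ι → ℝ := fun y c => A c y + τ • B c y with hAt
    set f : ι → Y → ℝ := fun a y =>
      χ (Ψ y + τ • β y) * detRowCM ι (Function.update (At y) a (β y)) with hf
    set f' : ι → Y → ℝ := fun a y =>
      fderiv ℝ χ (Ψ y + τ • β y) (At y a) * detRowCM ι (Function.update (At y) a (β y)) +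
      χ (Ψ y + τ • β y) * ∑ b, detRowCM ι (Function.update (Function.update (At y) a (β y)) b
        (if b = a then B a y else P a b y + τ • Q a b y)) with hf'
    have cAt : Continuous At := by simp only [hAt]; fun_prop
    have cU : ∀ a, Continuous fun y => Function.update (At y) a (β y) := fun a =>
      cAt.update a cβ
    have cf : ∀ a, Continuous (f a) := by
      intro a
      have := cdet.comp (cU a)
      simp only [hf]
      exact (cχ.comp (by fun_prop)).mul this
    have cf' : ∀ a, Continuous (f' a) := by
      intro a
      have h1 := cdet.comp (cU a)
      have h2 : ∀ b, Continuous fun y => detRowCM ι (Function.update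
          (Function.update (At y) a (β y)) b
            (if b = a then B a y else P a b y + τ • Q a b y)) := by
        intro b
        refine cdet.comp ((cU a).update b ?_)
        by_cases hb : b = a
        · simp only [hb, if_true]; exact cB a
        · simp only [hb, if_false]; fun_prop
      have h3 : Continuous fun y => Ψ y + τ • β y := by fun_prop
      have h4 : Continuous fun y => At y a := (continuous_apply a).comp cAt
      exact (((cχ'.comp h3).clm_apply h4).mul h1).add
        ((cχ.comp h3).mul (continuous_finsetSum _ fun b _ => h2 b))
    have df : ∀ a y, HasDerivAt (fun t => f a (φ a t y)) (f' a y) 0 := by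
      intro a y
      have dAt : ∀ b, HasDerivAt (fun t => At (φ a t y) b) (P a b y + τ • Q a b y) 0 :=
        fun b => (dA a b y).add ((dB a b y).const_smul τ)
      have d1 : HasDerivAt (fun t => Ψ (φ a t y) + τ • β (φ a t y)) (At y a) 0 :=
        (dΨ a y).add ((dβ a y).const_smul τ)
      have d2 : HasDerivAt (fun t => χ (Ψ (φ a t y) + τ • β (φ a t y)))
          (fderiv ℝ χ (Ψ y + τ • β y) (At y a)) 0 := by
        have h := ((hχ.differentiable one_ne_zero).differentiableAt
          (x := Ψ (φ a 0 y) + τ • β (φ a 0 y))).hasFDerivAt.comp_hasDerivAt 0 d1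
        rw [hφ0] at h
        exact h
      have d3 := HasDerivAt.detRowCM
        (A := fun t => Function.update (At (φ a t y)) a (β (φ a t y)))
        (A' := fun b => if b = a then B a y else P a b y + τ • Q a b y) (t := 0) (by
          intro b
          by_cases hb : b = a
          · subst hb; simpa using dβ b y
          · simpa [hb] using dAt b)
      have := d2.mul d3
      simp only [hφ0] at this
      exact this
    have hinteg : ∀ a, Integrable (f' a) μ ∧ ∫ y, f' a y ∂μ = 0 := by
      intro a
      refine ⟨?_, integral_flow_deriv_eq_zero μ (φ a) (hφ a) (hφ0 a) (hφadd a) (hmp a) (cf a)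
        (cf' a) (df a) hC fun y hy => by simp only [hf, hC0 y hy, zero_mul]⟩
      refine (cf' a).integrable_of_hasCompactSupport (HasCompactSupport.intro hC ?_)
      intro y hy
      have hev : ∀ᶠ t in 𝓝 (0 : ℝ), φ a t y ∉ C := by
        have h1 : Continuous fun t => φ a t y :=
          (hφ a).comp (by fun_prop : Continuous fun t : ℝ => (t, y))
        exact h1.continuousAt.eventually
          (hC.isClosed.isOpen_compl.mem_nhds (by simpa [hφ0] using hy))
      have h2 : HasDerivAt (fun t => f a (φ a t y)) 0 0 :=
        (hasDerivAt_const (0 : ℝ) (0 : ℝ)).congr_of_eventuallyEq (by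
          filter_upwards [hev] with t ht
          simp only [hf, hC0 _ ht, zero_mul])
      exact (df a y).unique h2
    have hsum : ∀ y, F' τ y = ∑ a, f' a y := by
      intro y
      have := sum_divergence_eq (At y) (β y) (fun a => B a y)
        (fun a b => P a b y + τ • Q a b y) (χ (Ψ y + τ • β y)) (fderiv ℝ χ (Ψ y + τ • β y))
        (fun a b hab => hanti y τ a b hab)
      simp only [hF', hf']
      exact this.symm
    simp only [hsum]
    rw [integral_finsetSum _ fun a _ => (hinteg a).1]
    exact Finset.sum_eq_zero fun a _ => (hinteg a).2
  have hc := is_const_of_deriv_eq_zero (f := fun τ => ∫ y, F τ y ∂μ)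
    (fun τ => (dF τ).differentiableAt) (fun τ => by rw [(dF τ).deriv, hzero]) τ 0
  simpa [hF] using hc

open scoped Matrix.Norms.Operator

/-- Complex `2n × 2n` matrices in block form. -/
abbrev Mat2 (n : ℕ) := Matrix (Fin n ⊕ Fin n) (Fin n ⊕ Fin n) ℂ

lemma Smat_transpose (n : ℕ) : (Smat n)ᵀ = Smat n := by
  simp [Smat, Matrix.fromBlocks_transpose]

lemma Smat_conjTranspose (n : ℕ) : (Smat n)ᴴ = Smat n := by
  simp [Smat, Matrix.fromBlocks_conjTranspose]

lemma Smat_sq (n : ℕ) : Smat n * Smat n = 1 := by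
  simp [Smat, Matrix.fromBlocks_multiply]

lemma Jnn_eq (n : ℕ) : Jnn n = Matrix.fromBlocks 1 0 0 (-1) := by
  ext i j
  rcases i with i | i <;> rcases j with j | j <;>
    simp [Jnn, Matrix.diagonal_apply, Matrix.one_apply] <;> split_ifs <;> simp

lemma Jnn_transpose (n : ℕ) : (Jnn n)ᵀ = Jnn n := by simp [Jnn]

lemma Jnn_conjTranspose (n : ℕ) : (Jnn n)ᴴ = Jnn n := by
  simp [Jnn_eq, Matrix.fromBlocks_conjTranspose]

lemma Jnn_sq (n : ℕ) : Jnn n * Jnn n = 1 := by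
  simp [Jnn_eq, Matrix.fromBlocks_multiply]

lemma Jnn_mul_Smat (n : ℕ) : Jnn n * Smat n = -(Smat n * Jnn n) := by
  simp [Jnn_eq, Smat, Matrix.fromBlocks_multiply, Matrix.fromBlocks_neg]

/-- The maximal compact subgroup of `SO(2n,ℂ)`. -/
def KSub (n : ℕ) : Subgroup (Matrix.unitaryGroup (Fin n ⊕ Fin n) ℂ) where
  carrier := {k | k.valᵀ * Smat n * k.val = Smat n ∧ k.val.det = 1}
  one_mem' := by constructor <;> simp
  mul_mem' := by
    rintro A B ⟨hA1, hA2⟩ ⟨hB1, hB2⟩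
    constructor
    · have key : (A * B).valᵀ * Smat n * (A * B).val =
          B.valᵀ * (A.valᵀ * Smat n * A.val) * B.val := by
        simp only [Submonoid.coe_mul, transpose_mul, Matrix.mul_assoc]
      rw [key, hA1]
      exact hB1
    · rw [Submonoid.coe_mul, det_mul, hA2, hB2, mul_one]
  inv_mem' := by
    rintro A ⟨hA1, hA2⟩
    have h1 : A.val * (A⁻¹).val = 1 := by
      rw [← Submonoid.coe_mul, mul_inv_cancel]; rfl
    constructor
    · calc (A⁻¹).valᵀ * Smat n * (A⁻¹).val
          = (A⁻¹).valᵀ * (A.valᵀ * Smat n * A.val) * (A⁻¹).val := by rw [hA1]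
        _ = (A.val * (A⁻¹).val)ᵀ * Smat n * (A.val * (A⁻¹).val) := by
            rw [transpose_mul]
            simp only [Matrix.mul_assoc]
        _ = Smat n := by rw [h1]; simp
    · have h := congrArg Matrix.det h1
      rw [det_mul, hA2, one_mul] at h
      simpa using h

/-- The matrix underlying an element of the maximal compact subgroup. -/
def kmat {n : ℕ} (k : KSub n) : Mat2 n := k.val.val

lemma kmat_star_mul {n : ℕ} (k : KSub n) : (kmat k)ᴴ * kmat k = 1 :=
  Unitary.coe_star_mul_self k.val

lemma kmat_mul_star {n : ℕ} (k : KSub n) : kmat k * (kmat k)ᴴ = 1 :=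
  Unitary.coe_mul_star_self k.val

lemma kmat_S {n : ℕ} (k : KSub n) : (kmat k)ᵀ * Smat n * kmat k = Smat n := k.2.1

lemma kmat_det {n : ℕ} (k : KSub n) : (kmat k).det = 1 := k.2.2

lemma kmat_mul {n : ℕ} (k l : KSub n) : kmat (k * l) = kmat k * kmat l := rfl

lemma kmat_one (n : ℕ) : kmat (1 : KSub n) = 1 := rfl

lemma kmat_inv {n : ℕ} (k : KSub n) : kmat k⁻¹ = (kmat k)ᴴ := rfl

lemma isEmbedding_kmat (n : ℕ) : IsEmbedding (kmat (n := n)) :=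
  IsEmbedding.subtypeVal.comp IsEmbedding.subtypeVal

lemma continuous_kmat (n : ℕ) : Continuous (kmat (n := n)) := (isEmbedding_kmat n).continuous

/-- Build an element of the maximal compact subgroup from a matrix. -/
def kmk {n : ℕ} (A : Mat2 n) (h1 : Aᴴ * A = 1) (h2 : Aᵀ * Smat n * A = Smat n)
    (h3 : A.det = 1) : KSub n :=
  ⟨⟨A, ⟨h1, mul_eq_one_comm.mp h1⟩⟩, h2, h3⟩

lemma range_kmat (n : ℕ) : Set.range (kmat (n := n)) =
    {A | Aᴴ * A = 1 ∧ Aᵀ * Smat n * A = Smat n ∧ A.det = 1} := by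
  ext A
  constructor
  · rintro ⟨k, rfl⟩
    exact ⟨kmat_star_mul k, kmat_S k, kmat_det k⟩
  · rintro ⟨h1, h2, h3⟩
    exact ⟨kmk A h1 h2 h3, rfl⟩

lemma isClosedEmbedding_kmat (n : ℕ) : IsClosedEmbedding (kmat (n := n)) := by
  refine ⟨isEmbedding_kmat n, ?_⟩
  rw [range_kmat]
  have c1 : Continuous fun A : Mat2 n => Aᴴ * A := by fun_prop
  have c2 : Continuous fun A : Mat2 n => Aᵀ * Smat n * A := by fun_prop
  have c3 : Continuous fun A : Mat2 n => A.det := by fun_prop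
  exact (isClosed_eq c1 continuous_const).inter
    ((isClosed_eq c2 continuous_const).inter (isClosed_eq c3 continuous_const))

instance compactSpace_KSub (n : ℕ) : CompactSpace (KSub n) := by
  have hc : IsCompact (Set.range (kmat (n := n))) := by
    have hsub : Set.range (kmat (n := n)) ⊆
        Set.pi Set.univ fun _ => Set.pi Set.univ fun _ => Metric.closedBall (0 : ℂ) 1 := by
      rintro _ ⟨k, rfl⟩ i _ j _
      rw [mem_closedBall_zero_iff]
      exact entry_norm_bound_of_unitary k.val.2 i j
    exact IsCompact.of_isClosed_subset
      (isCompact_univ_pi fun _ => isCompact_univ_pi fun _ => isCompact_closedBall _ _)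
      (isClosedEmbedding_kmat n).isClosed_range hsub
  have := (isClosedEmbedding_kmat n).isCompact_preimage hc
  rw [Set.preimage_range] at this
  exact ⟨this⟩

instance secondCountable_KSub (n : ℕ) : SecondCountableTopology (KSub n) :=
  have : SecondCountableTopology (Mat2 n) :=
    inferInstanceAs (SecondCountableTopology ((Fin n ⊕ Fin n) → (Fin n ⊕ Fin n) → ℂ))
  (isEmbedding_kmat n).secondCountableTopology

instance (n : ℕ) : MeasurableSpace (KSub n) := borel _
instance (n : ℕ) : BorelSpace (KSub n) := ⟨rfl⟩

/-- The `-1` eigenspace of the involution on the Lie algebra of the maximal compact subgroup. -/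
def qSub (n : ℕ) : Submodule ℝ (Mat2 n) where
  carrier := {W | Wᴴ = -W ∧ Wᵀ * Smat n = -(Smat n * W) ∧ W * Jnn n = -(Jnn n * W)}
  zero_mem' := by simp
  add_mem' := by
    rintro A B ⟨a1, a2, a3⟩ ⟨b1, b2, b3⟩
    refine ⟨?_, ?_, ?_⟩
    · rw [conjTranspose_add, a1, b1]; abel
    · rw [transpose_add, add_mul, a2, b2, mul_add]; abel
    · rw [add_mul, a3, b3, mul_add]; abel
  smul_mem' := by
    rintro c A ⟨a1, a2, a3⟩
    refine ⟨?_, ?_, ?_⟩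
    · rw [conjTranspose_smul, a1]; simp
    · rw [transpose_smul, smul_mul_assoc, a2, mul_smul_comm, smul_neg]
    · rw [smul_mul_assoc, a3, mul_smul_comm, smul_neg]

/-- The `+1` eigenspace of the involution on the Lie algebra of the maximal compact subgroup. -/
def uSub (n : ℕ) : Submodule ℝ (Mat2 n) where
  carrier := {W | Wᴴ = -W ∧ Wᵀ * Smat n = -(Smat n * W) ∧ W * Jnn n = Jnn n * W}
  zero_mem' := by simp
  add_mem' := by
    rintro A B ⟨a1, a2, a3⟩ ⟨b1, b2, b3⟩
    refine ⟨?_, ?_, ?_⟩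
    · rw [conjTranspose_add, a1, b1]; abel
    · rw [transpose_add, add_mul, a2, b2, mul_add]; abel
    · rw [add_mul, a3, b3, mul_add]
  smul_mem' := by
    rintro c A ⟨a1, a2, a3⟩
    refine ⟨?_, ?_, ?_⟩
    · rw [conjTranspose_smul, a1]; simp
    · rw [transpose_smul, smul_mul_assoc, a2, mul_smul_comm, smul_neg]
    · rw [smul_mul_assoc, a3, mul_smul_comm]

/-- The Lie algebra of the maximal compact subgroup. -/
def vSub (n : ℕ) : Submodule ℝ (Mat2 n) where
  carrier := {W | Wᴴ = -W ∧ Wᵀ * Smat n = -(Smat n * W)}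
  zero_mem' := by simp
  add_mem' := by
    rintro A B ⟨a1, a2⟩ ⟨b1, b2⟩
    refine ⟨?_, ?_⟩
    · rw [conjTranspose_add, a1, b1]; abel
    · rw [transpose_add, add_mul, a2, b2, mul_add]; abel
  smul_mem' := by
    rintro c A ⟨a1, a2⟩
    refine ⟨?_, ?_⟩
    · rw [conjTranspose_smul, a1]; simp
    · rw [transpose_smul, smul_mul_assoc, a2, mul_smul_comm, smul_neg]

lemma qSub_le_vSub (n : ℕ) : qSub n ≤ vSub n := fun _ h => ⟨h.1, h.2.1⟩

lemma uSub_le_vSub (n : ℕ) : uSub n ≤ vSub n := fun _ h => ⟨h.1, h.2.1⟩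

lemma conj_J_mem_vSub {n : ℕ} {W : Mat2 n} (h : W ∈ vSub n) : Jnn n * W * Jnn n ∈ vSub n := by
  obtain ⟨h1, h2⟩ := h
  refine ⟨?_, ?_⟩
  · simp only [conjTranspose_mul, Jnn_conjTranspose, h1]; noncomm_ring
  · calc (Jnn n * W * Jnn n)ᵀ * Smat n = Jnn n * Wᵀ * (Jnn n * Smat n) := by
          simp only [transpose_mul, Jnn_transpose, Matrix.mul_assoc]
      _ = -(Jnn n * (Wᵀ * Smat n) * Jnn n) := by rw [Jnn_mul_Smat]; noncomm_ring
      _ = (Jnn n * Smat n) * W * Jnn n := by rw [h2]; noncomm_ring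
      _ = -(Smat n * (Jnn n * W * Jnn n)) := by rw [Jnn_mul_Smat]; noncomm_ring

lemma disjoint_qSub_uSub (n : ℕ) : Disjoint (qSub n) (uSub n) := by
  rw [Submodule.disjoint_def]
  rintro W ⟨_, _, h1⟩ ⟨_, _, h2⟩
  have h3 : W * Jnn n = 0 := by
    rw [h2] at h1
    have : (2 : ℂ) • (Jnn n * W) = 0 := by rw [two_smul]; nth_rewrite 1 [h1]; simp
    rw [h2]
    exact (smul_eq_zero.mp this).resolve_left two_ne_zero
  calc W = W * (Jnn n * Jnn n) := by rw [Jnn_sq, mul_one]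
    _ = W * Jnn n * Jnn n := by rw [Matrix.mul_assoc]
    _ = 0 := by rw [h3, zero_mul]

lemma exists_decomp {n : ℕ} {W : Mat2 n} (h : W ∈ vSub n) :
    ∃ v ∈ qSub n, ∃ w ∈ uSub n, W = v + w := by
  have hJ := conj_J_mem_vSub h
  have e1 : Jnn n * W * Jnn n * Jnn n = Jnn n * W := by
    rw [Matrix.mul_assoc, Jnn_sq, mul_one]
  have e2 : Jnn n * (Jnn n * W * Jnn n) = W * Jnn n := by
    rw [← Matrix.mul_assoc, ← Matrix.mul_assoc, Jnn_sq, one_mul]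
  have a1 := (vSub n).smul_mem (1 / 2 : ℝ) ((vSub n).sub_mem h hJ)
  have a2 := (vSub n).smul_mem (1 / 2 : ℝ) ((vSub n).add_mem h hJ)
  refine ⟨(1 / 2 : ℝ) • (W - Jnn n * W * Jnn n), ⟨a1.1, a1.2, ?_⟩,
    (1 / 2 : ℝ) • (W + Jnn n * W * Jnn n), ⟨a2.1, a2.2, ?_⟩, ?_⟩
  · rw [smul_mul_assoc, mul_smul_comm, ← smul_neg, sub_mul, mul_sub, e1, e2, neg_sub]
  · rw [smul_mul_assoc, mul_smul_comm, add_mul, mul_add, e1, e2, add_comm]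
  · module

lemma lie_mem_vSub {n : ℕ} {A B : Mat2 n} (hA : A ∈ vSub n) (hB : B ∈ vSub n) :
    ⁅A, B⁆ ∈ vSub n := by
  obtain ⟨a1, a2⟩ := hA
  obtain ⟨b1, b2⟩ := hB
  rw [Ring.lie_def]
  refine ⟨?_, ?_⟩
  · rw [conjTranspose_sub, conjTranspose_mul, conjTranspose_mul, a1, b1]; noncomm_ring
  · rw [transpose_sub, transpose_mul, transpose_mul, sub_mul, Matrix.mul_assoc, a2,
      Matrix.mul_assoc, b2, mul_neg, mul_neg, ← Matrix.mul_assoc, ← Matrix.mul_assoc, a2, b2]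
    noncomm_ring

lemma lie_q_q {n : ℕ} {A B : Mat2 n} (hA : A ∈ qSub n) (hB : B ∈ qSub n) :
    ⁅A, B⁆ ∈ uSub n := by
  have h := lie_mem_vSub (qSub_le_vSub n hA) (qSub_le_vSub n hB)
  refine ⟨h.1, h.2, ?_⟩
  have a3 := hA.2.2
  have b3 := hB.2.2
  rw [Ring.lie_def, sub_mul, Matrix.mul_assoc, b3, Matrix.mul_assoc, a3, mul_neg, mul_neg,
    ← Matrix.mul_assoc, ← Matrix.mul_assoc, a3, b3]
  noncomm_ring

lemma lie_u_u {n : ℕ} {A B : Mat2 n} (hA : A ∈ uSub n) (hB : B ∈ uSub n) :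
    ⁅A, B⁆ ∈ uSub n := by
  have h := lie_mem_vSub (uSub_le_vSub n hA) (uSub_le_vSub n hB)
  refine ⟨h.1, h.2, ?_⟩
  have a3 := hA.2.2
  have b3 := hB.2.2
  rw [Ring.lie_def, sub_mul, Matrix.mul_assoc, b3, Matrix.mul_assoc, a3,
    ← Matrix.mul_assoc, ← Matrix.mul_assoc, a3, b3]
  noncomm_ring

lemma lie_q_u {n : ℕ} {A B : Mat2 n} (hA : A ∈ qSub n) (hB : B ∈ uSub n) :
    ⁅A, B⁆ ∈ qSub n := by
  have h := lie_mem_vSub (qSub_le_vSub n hA) (uSub_le_vSub n hB)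
  refine ⟨h.1, h.2, ?_⟩
  have a3 := hA.2.2
  have b3 := hB.2.2
  rw [Ring.lie_def, sub_mul, Matrix.mul_assoc, b3, Matrix.mul_assoc, a3, mul_neg,
    ← Matrix.mul_assoc, ← Matrix.mul_assoc, a3, b3]
  noncomm_ring

/-- Conjugation by an element of the maximal compact subgroup. -/
def cj {n : ℕ} (k : KSub n) : Mat2 n →ₗ[ℝ] Mat2 n where
  toFun W := kmat k * W * (kmat k)ᴴ
  map_add' A B := by noncomm_ring
  map_smul' c A := by simp

lemma cj_apply {n : ℕ} (k : KSub n) (W : Mat2 n) : cj k W = kmat k * W * (kmat k)ᴴ := rfl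

lemma cj_mul {n : ℕ} (k l : KSub n) (W : Mat2 n) : cj (k * l) W = cj k (cj l W) := by
  simp only [cj_apply, kmat_mul, conjTranspose_mul, Matrix.mul_assoc]

lemma cj_one {n : ℕ} (W : Mat2 n) : cj 1 W = W := by simp [cj_apply, kmat_one]

lemma cj_inv_cj {n : ℕ} (k : KSub n) (W : Mat2 n) : cj k⁻¹ (cj k W) = W := by
  rw [← cj_mul, inv_mul_cancel, cj_one]

lemma continuous_cj (n : ℕ) : Continuous fun p : KSub n × Mat2 n => cj p.1 p.2 := by
  simp only [cj_apply]
  have := (continuous_kmat n).comp (continuous_fst (X := KSub n) (Y := Mat2 n))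
  exact (this.matrix_mul continuous_snd).matrix_mul this.matrix_conjTranspose

lemma kmat_S_mul {n : ℕ} (k : KSub n) : Smat n * kmat k = ((kmat k)ᴴ)ᵀ * Smat n := by
  have h1 : ((kmat k)ᴴ)ᵀ * (kmat k)ᵀ = 1 := by
    rw [← transpose_mul, kmat_mul_star, transpose_one]
  calc Smat n * kmat k = ((kmat k)ᴴ)ᵀ * (kmat k)ᵀ * (Smat n * kmat k) := by rw [h1, one_mul]
    _ = ((kmat k)ᴴ)ᵀ * ((kmat k)ᵀ * Smat n * kmat k) := by simp only [Matrix.mul_assoc]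
    _ = _ := by rw [kmat_S]

lemma cj_mem_vSub {n : ℕ} (k : KSub n) {W : Mat2 n} (h : W ∈ vSub n) : cj k W ∈ vSub n := by
  obtain ⟨h1, h2⟩ := h
  have e1 := kmat_S_mul k
  have e2 : Smat n * (kmat k)ᴴ = (kmat k)ᵀ * Smat n := by
    have := kmat_S_mul k⁻¹
    rw [kmat_inv, conjTranspose_conjTranspose] at this
    exact this
  rw [cj_apply]
  refine ⟨?_, ?_⟩
  · simp only [conjTranspose_mul, conjTranspose_conjTranspose, h1]; noncomm_ring
  · calc (kmat k * W * (kmat k)ᴴ)ᵀ * Smat n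
        = ((kmat k)ᴴ)ᵀ * (Wᵀ * ((kmat k)ᵀ * Smat n)) := by
          simp only [transpose_mul, Matrix.mul_assoc]
      _ = ((kmat k)ᴴ)ᵀ * (Wᵀ * Smat n) * (kmat k)ᴴ := by rw [← e2]; simp only [Matrix.mul_assoc]
      _ = -((((kmat k)ᴴ)ᵀ * Smat n) * W * (kmat k)ᴴ) := by rw [h2]; noncomm_ring
      _ = _ := by rw [← e1]; noncomm_ring

/-- The one-parameter subgroup generated by an element of the Lie algebra. -/
lemma exp_mem_K {n : ℕ} {W : Mat2 n} (h : W ∈ vSub n) :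
    (NormedSpace.exp W)ᴴ * NormedSpace.exp W = 1 ∧
    (NormedSpace.exp W)ᵀ * Smat n * NormedSpace.exp W = Smat n ∧
    (NormedSpace.exp W).det = 1 := by
  have key : ∀ X ∈ vSub n, (NormedSpace.exp X)ᵀ * Smat n * NormedSpace.exp X = Smat n := by
    intro X hX
    have hS : IsUnit (Smat n) := IsUnit.of_mul_eq_one _ (Smat_sq n)
    have hSi : (Smat n)⁻¹ = Smat n := Matrix.inv_eq_right_inv (Smat_sq n)
    have h1 : NormedSpace.exp Xᵀ = Smat n * NormedSpace.exp (-X) * Smat n := by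
      have := Matrix.exp_conj (Smat n) (-X) hS
      rw [hSi] at this
      rw [← this]
      congr 1
      have h2 := hX.2
      calc Xᵀ = Xᵀ * Smat n * Smat n := by rw [Matrix.mul_assoc, Smat_sq, mul_one]
        _ = _ := by rw [h2]; noncomm_ring
    rw [← Matrix.exp_transpose, h1, Matrix.mul_assoc _ (Smat n) (Smat n), Smat_sq, mul_one,
      Matrix.mul_assoc, ← Matrix.exp_add_of_commute (-X) X ((Commute.refl X).neg_left)]
    simp
  refine ⟨?_, key W h, ?_⟩
  · rw [← Matrix.exp_conjTranspose, h.1,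
      ← Matrix.exp_add_of_commute (-W) W ((Commute.refl W).neg_left)]
    simp
  · have h2 := (vSub n).smul_mem (1 / 2 : ℝ) h
    have h3 := key _ h2
    have h4 : NormedSpace.exp W =
        NormedSpace.exp ((1 / 2 : ℝ) • W) * NormedSpace.exp ((1 / 2 : ℝ) • W) := by
      rw [← Matrix.exp_add_of_commute _ _ rfl]
      congr 1
      module
    have h5 := congrArg Matrix.det h3
    have h6 : (Smat n).det * (Smat n).det = 1 := by rw [← det_mul, Smat_sq, det_one]
    rw [det_mul, det_mul, det_transpose] at h5
    rw [h4, det_mul]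
    have h7 : (Smat n).det ≠ 0 := fun h => by simp [h] at h6
    apply mul_left_cancel₀ h7
    rw [mul_one]
    linear_combination h5

/-- The one-parameter subgroup of the maximal compact subgroup. -/
def expK {n : ℕ} (W : Mat2 n) (h : W ∈ vSub n) (t : ℝ) : KSub n :=
  kmk (NormedSpace.exp (t • W)) (exp_mem_K ((vSub n).smul_mem t h)).1
    (exp_mem_K ((vSub n).smul_mem t h)).2.1 (exp_mem_K ((vSub n).smul_mem t h)).2.2

lemma kmat_expK {n : ℕ} (W : Mat2 n) (h : W ∈ vSub n) (t : ℝ) :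
    kmat (expK W h t) = NormedSpace.exp (t • W) := rfl

lemma kmat_injective (n : ℕ) : Function.Injective (kmat (n := n)) := (isEmbedding_kmat n).injective

lemma expK_zero {n : ℕ} (W : Mat2 n) (h : W ∈ vSub n) : expK W h 0 = 1 := by
  apply kmat_injective; simp [kmat_expK, kmat_one]

lemma expK_add {n : ℕ} (W : Mat2 n) (h : W ∈ vSub n) (s t : ℝ) :
    expK W h (s + t) = expK W h s * expK W h t := by
  apply kmat_injective
  rw [kmat_mul, kmat_expK, kmat_expK, kmat_expK, add_smul]
  exact Matrix.exp_add_of_commute _ _ (((Commute.refl W).smul_left s).smul_right t)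

lemma continuous_expK {n : ℕ} (W : Mat2 n) (h : W ∈ vSub n) : Continuous (expK W h) := by
  rw [(isEmbedding_kmat n).continuous_iff]
  change Continuous fun t : ℝ => NormedSpace.exp (t • W)
  exact continuous_iff_continuousAt.2 fun t => (hasDerivAt_exp_smul_const W t).continuousAt

lemma hasDerivAt_cj_expK {n : ℕ} (k : KSub n) (E W : Mat2 n) (h : E ∈ vSub n) :
    HasDerivAt (fun t => cj (k * expK E h t) W) (cj k ⁅E, W⁆) 0 := by
  have h1 : HasDerivAt (fun t : ℝ => NormedSpace.exp (t • E)) E 0 := by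
    have := hasDerivAt_exp_smul_const E (0 : ℝ)
    rw [zero_smul, NormedSpace.exp_zero, one_mul] at this
    exact this
  have h2 : HasDerivAt (fun t : ℝ => NormedSpace.exp (t • (-E))) (-E) 0 := by
    have := hasDerivAt_exp_smul_const (-E) (0 : ℝ)
    rw [zero_smul, NormedSpace.exp_zero, one_mul] at this
    exact this
  have h3 := ((h1.mul_const W).mul h2)
  have h4 := ((h3.const_mul (kmat k)).mul_const (kmat k)ᴴ)
  have e : kmat k * (E * W * NormedSpace.exp ((0 : ℝ) • (-E)) +
      NormedSpace.exp ((0 : ℝ) • E) * W * (-E)) * (kmat k)ᴴ = cj k ⁅E, W⁆ := by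
    rw [cj_apply, Ring.lie_def]; simp [sub_eq_add_neg]
  rw [e] at h4
  refine h4.congr_of_eventuallyEq (Filter.Eventually.of_forall fun t => ?_)
  have e2 : (NormedSpace.exp (t • E))ᴴ = NormedSpace.exp (t • (-E)) := by
    rw [← Matrix.exp_conjTranspose, conjTranspose_smul, h.1]; simp
  simp only [cj_apply, kmat_mul, kmat_expK, conjTranspose_mul, e2, Matrix.mul_assoc, Pi.mul_apply]

attribute [irreducible] cj expK kmat

/-- Index set of a basis of `qSub n`. -/
abbrev Iq (n : ℕ) : Type := Fin (Module.finrank ℝ (qSub n))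

/-- Index set of a basis of `uSub n`. -/
abbrev Iu (n : ℕ) : Type := Fin (Module.finrank ℝ (uSub n))

/-- A basis of the Lie algebra adapted to the decomposition `q ⊕ u`. -/
def Ef (n : ℕ) : Iq n ⊕ Iu n → Mat2 n :=
  Sum.elim (fun a => (Module.finBasis ℝ (qSub n) a : Mat2 n))
    (fun c => (Module.finBasis ℝ (uSub n) c : Mat2 n))

lemma Ef_inl (n : ℕ) (a : Iq n) : Ef n (Sum.inl a) ∈ qSub n := (Module.finBasis ℝ (qSub n) a).2

lemma Ef_inr (n : ℕ) (c : Iu n) : Ef n (Sum.inr c) ∈ uSub n := (Module.finBasis ℝ (uSub n) c).2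

lemma Ef_mem (n : ℕ) (a : Iq n ⊕ Iu n) : Ef n a ∈ vSub n := by
  rcases a with a | a
  · exact qSub_le_vSub n (Ef_inl n a)
  · exact uSub_le_vSub n (Ef_inr n a)

/-- The Lie algebra element with given coordinates. -/
def comb (n : ℕ) : (Iq n ⊕ Iu n → ℝ) →ₗ[ℝ] Mat2 n := Fintype.linearCombination ℝ (Ef n)

lemma comb_apply (n : ℕ) (v : Iq n ⊕ Iu n → ℝ) : comb n v = ∑ i, v i • Ef n i :=
  Fintype.linearCombination_apply ℝ (Ef n) v

lemma qSub_eq_sum {n : ℕ} {W : Mat2 n} (h : W ∈ qSub n) :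
    ∃ v : Iq n → ℝ, W = ∑ a, v a • Ef n (Sum.inl a) := by
  refine ⟨(Module.finBasis ℝ (qSub n)).repr ⟨W, h⟩, ?_⟩
  have := congrArg Subtype.val ((Module.finBasis ℝ (qSub n)).sum_repr ⟨W, h⟩)
  rw [Submodule.coe_sum] at this
  exact this.symm

lemma uSub_eq_sum {n : ℕ} {W : Mat2 n} (h : W ∈ uSub n) :
    ∃ v : Iu n → ℝ, W = ∑ a, v a • Ef n (Sum.inr a) := by
  refine ⟨(Module.finBasis ℝ (uSub n)).repr ⟨W, h⟩, ?_⟩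
  have := congrArg Subtype.val ((Module.finBasis ℝ (uSub n)).sum_repr ⟨W, h⟩)
  rw [Submodule.coe_sum] at this
  exact this.symm

lemma comb_injective (n : ℕ) : Function.Injective (comb n) := by
  rw [← LinearMap.ker_eq_bot, LinearMap.ker_eq_bot']
  intro v hv
  rw [comb_apply, Fintype.sum_sum_type] at hv
  have h1 : ∑ a, v (Sum.inl a) • Ef n (Sum.inl a) ∈ qSub n :=
    (qSub n).sum_mem fun i _ => (qSub n).smul_mem _ (Ef_inl n i)
  have h2 : ∑ a, v (Sum.inr a) • Ef n (Sum.inr a) ∈ uSub n :=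
    (uSub n).sum_mem fun i _ => (uSub n).smul_mem _ (Ef_inr n i)
  have h3 := eq_neg_of_add_eq_zero_left hv
  have h4 := Submodule.disjoint_def.1 (disjoint_qSub_uSub n) _ h1
    (by rw [h3]; exact (uSub n).neg_mem h2)
  rw [h4, zero_add] at hv
  have l1 : ∀ a, v (Sum.inl a) = 0 := by
    refine Fintype.linearIndependent_iff.1 (Module.finBasis ℝ (qSub n)).linearIndependent
      (fun a => v (Sum.inl a)) ?_
    apply Subtype.ext
    simpa [Ef] using h4
  have l2 : ∀ a, v (Sum.inr a) = 0 := by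
    refine Fintype.linearIndependent_iff.1 (Module.finBasis ℝ (uSub n)).linearIndependent
      (fun a => v (Sum.inr a)) ?_
    apply Subtype.ext
    simpa [Ef] using hv
  ext i
  rcases i with a | a
  · exact l1 a
  · exact l2 a

/-- Arrays of complex numbers, with the product normed space structure. -/
abbrev Arr (n : ℕ) := (Fin n ⊕ Fin n) → (Fin n ⊕ Fin n) → ℂ

/-- The entries of a matrix. -/
def ent (n : ℕ) : Mat2 n →ₗ[ℝ] Arr n where
  toFun W := fun i j => W i j
  map_add' _ _ := rfl
  map_smul' _ _ := rfl

/-- The matrix with given entries. -/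
def ofArr (n : ℕ) : Arr n →ₗ[ℝ] Mat2 n where
  toFun W := Matrix.of W
  map_add' _ _ := rfl
  map_smul' _ _ := rfl

lemma ofArr_ent (n : ℕ) (W : Mat2 n) : ofArr n (ent n W) = W := rfl

lemma continuous_ent (n : ℕ) : Continuous (ent n) := continuous_id

lemma exists_coord (n : ℕ) : ∃ l : Mat2 n →ₗ[ℝ] (Iq n ⊕ Iu n → ℝ), l ∘ₗ comb n = LinearMap.id :=
  LinearMap.exists_leftInverse_of_injective _ (LinearMap.ker_eq_bot.2 (comb_injective n))

/-- Coordinates with respect to the adapted basis. -/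
def coord (n : ℕ) : Mat2 n →ₗ[ℝ] (Iq n ⊕ Iu n → ℝ) := (exists_coord n).choose

/-- Coordinates as a continuous linear map on arrays. -/
def coordC (n : ℕ) : Arr n →L[ℝ] (Iq n ⊕ Iu n → ℝ) :=
  LinearMap.toContinuousLinearMap (coord n ∘ₗ ofArr n)

lemma continuous_coord (n : ℕ) : Continuous (coord n) :=
  (coordC n).continuous.comp (continuous_ent n)

lemma hasDerivAt_ent_cj {n : ℕ} (k : KSub n) (E W : Mat2 n) (h : E ∈ vSub n) :
    HasDerivAt (fun t => ent n (cj (k * expK E h t) W)) (ent n (cj k ⁅E, W⁆)) 0 :=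
  hasDerivAt_cj_expK k E W h

lemma hasDerivAt_coord_cj {n : ℕ} (k : KSub n) (E W : Mat2 n) (h : E ∈ vSub n) :
    HasDerivAt (fun t => coord n (cj (k * expK E h t) W)) (coord n (cj k ⁅E, W⁆)) 0 :=
  (coordC n).hasFDerivAt.comp_hasDerivAt 0 (hasDerivAt_ent_cj k E W h)

lemma lie_jacobi_ring {n : ℕ} (A B C : Mat2 n) : ⁅A, ⁅B, C⁆⁆ = ⁅⁅A, B⁆, C⁆ + ⁅B, ⁅A, C⁆⁆ := by
  simp only [Ring.lie_def]; noncomm_ring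

lemma coord_comb (n : ℕ) (v : Iq n ⊕ Iu n → ℝ) : coord n (comb n v) = v :=
  LinearMap.congr_fun (exists_coord n).choose_spec v

lemma comb_coord {n : ℕ} {W : Mat2 n} (h : W ∈ vSub n) : comb n (coord n W) = W := by
  obtain ⟨A, hA, B, hB, rfl⟩ := exists_decomp h
  obtain ⟨v, hv⟩ := qSub_eq_sum hA
  obtain ⟨w, hw⟩ := uSub_eq_sum hB
  have : A + B = comb n (Sum.elim v w) := by
    rw [comb_apply, Fintype.sum_sum_type, hv, hw]; simp
  rw [this, coord_comb]

/-- The element of `uSub n` with given coordinates. -/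
def combU (n : ℕ) : (Iu n → ℝ) →ₗ[ℝ] Mat2 n :=
  Fintype.linearCombination ℝ fun c => Ef n (Sum.inr c)

lemma combU_apply (n : ℕ) (ξ : Iu n → ℝ) : combU n ξ = ∑ c, ξ c • Ef n (Sum.inr c) :=
  Fintype.linearCombination_apply ℝ _ ξ

lemma combU_mem (n : ℕ) (ξ : Iu n → ℝ) : combU n ξ ∈ uSub n := by
  rw [combU_apply]
  exact (uSub n).sum_mem fun i _ => (uSub n).smul_mem _ (Ef_inr n i)

lemma combU_single (n : ℕ) (c : Iu n) : combU n (Pi.single c 1) = Ef n (Sum.inr c) := by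
  rw [combU, Fintype.linearCombination_apply_single, one_smul]

lemma coord_combU (n : ℕ) (ξ : Iu n → ℝ) (c : Iu n) : coord n (combU n ξ) (Sum.inr c) = ξ c := by
  have : combU n ξ = comb n (Sum.elim 0 ξ) := by
    rw [comb_apply, combU_apply, Fintype.sum_sum_type]; simp
  rw [this, coord_comb]; rfl

lemma continuous_combU (n : ℕ) : Continuous (combU n) :=
  LinearMap.continuous_of_finiteDimensional _

/-- The space on which the degree integral lives. -/
abbrev Ysp (n : ℕ) : Type := KSub n × (Iu n → ℝ)

/-- Infinitesimal variations of `cj k X`. -/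
def Lb {n : ℕ} (a : Iq n ⊕ Iu n) (ξ : Iu n → ℝ) : Mat2 n :=
  Sum.elim (fun a' => ⁅Ef n (Sum.inl a'), combU n ξ⁆) (fun c => Ef n (Sum.inr c)) a

lemma continuous_lie {n : ℕ} (A : Mat2 n) : Continuous fun B : Mat2 n => ⁅A, B⁆ := by
  simp only [Ring.lie_def]; fun_prop

lemma continuous_Lb {n : ℕ} (a : Iq n ⊕ Iu n) : Continuous (Lb (n := n) a) := by
  rcases a with a | a
  · exact (continuous_lie _).comp (continuous_combU n)
  · exact continuous_const

lemma Lb_mem {n : ℕ} (a : Iq n ⊕ Iu n) (ξ : Iu n → ℝ) : Lb a ξ ∈ vSub n := by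
  rcases a with a | a
  · exact lie_mem_vSub (Ef_mem n _) (uSub_le_vSub n (combU_mem n ξ))
  · exact Ef_mem n (Sum.inr a)

/-- The flows on `Ysp n`. -/
def flow {n : ℕ} : Iq n ⊕ Iu n → ℝ → Ysp n → Ysp n
  | Sum.inl a, t, y => (y.1 * expK (Ef n (Sum.inl a)) (Ef_mem n _) t, y.2)
  | Sum.inr c, t, y => (y.1, y.2 + t • Pi.single c 1)

lemma continuous_flow {n : ℕ} (a : Iq n ⊕ Iu n) :
    Continuous fun p : ℝ × Ysp n => flow a p.1 p.2 := by
  rcases a with a | a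
  · have := (continuous_expK (Ef n (Sum.inl a)) (Ef_mem n _)).comp
      (continuous_fst (X := ℝ) (Y := Ysp n))
    exact ((continuous_fst.comp continuous_snd).mul this).prodMk
      (continuous_snd.comp continuous_snd)
  · simp only [flow]; fun_prop

lemma flow_zero {n : ℕ} (a : Iq n ⊕ Iu n) (y : Ysp n) : flow a 0 y = y := by
  rcases a with a | a <;> simp [flow, expK_zero]

lemma flow_add {n : ℕ} (a : Iq n ⊕ Iu n) (s t : ℝ) (y : Ysp n) :
    flow a s (flow a t y) = flow a (s + t) y := by
  rcases a with a | a
  · simp only [flow, mul_assoc, ← expK_add, add_comm s t]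
  · simp only [flow, add_smul, add_assoc, add_comm (s • _)]

lemma hasDerivAt_flow_inr {n : ℕ} (c : Iu n) (y : Ysp n) {F : Type} [NormedAddCommGroup F]
    [NormedSpace ℝ F] (T : Mat2 n →ₗ[ℝ] F) :
    HasDerivAt (fun t : ℝ => T (combU n (y.2 + t • Pi.single c 1))) (T (Ef n (Sum.inr c))) 0 := by
  have h : (fun t : ℝ => T (combU n (y.2 + t • Pi.single c 1))) =
      fun t : ℝ => T (combU n y.2) + t • T (Ef n (Sum.inr c)) := by
    funext t
    rw [map_add, map_smul, combU_single, map_add, map_smul]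
  rw [h]
  simpa using ((hasDerivAt_id (0 : ℝ)).smul_const (T (Ef n (Sum.inr c)))).const_add
    (T (combU n y.2))

/-- The unperturbed map. -/
def Psi0 {n : ℕ} (y : Ysp n) : Iq n ⊕ Iu n → ℝ := coord n (cj y.1 (combU n y.2))

/-- First derivatives of `Psi0`. -/
def A0 {n : ℕ} (a : Iq n ⊕ Iu n) (y : Ysp n) : Iq n ⊕ Iu n → ℝ := coord n (cj y.1 (Lb a y.2))

/-- Second derivatives of `Psi0`. -/
def P0 {n : ℕ} : Iq n ⊕ Iu n → Iq n ⊕ Iu n → Ysp n → Iq n ⊕ Iu n → ℝ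
  | Sum.inl a, b, y => coord n (cj y.1 ⁅Ef n (Sum.inl a), Lb b y.2⁆)
  | Sum.inr a, Sum.inl b, y => coord n (cj y.1 ⁅Ef n (Sum.inl b), Ef n (Sum.inr a)⁆)
  | Sum.inr _, Sum.inr _, _ => 0

attribute [irreducible] coord comb combU ent

lemma continuous_coord_cj {n : ℕ} {f : (Iu n → ℝ) → Mat2 n} (hf : Continuous f) :
    Continuous fun y : Ysp n => coord n (cj y.1 (f y.2)) :=
  (continuous_coord n).comp ((continuous_cj n).comp
    (continuous_fst.prodMk (hf.comp continuous_snd)))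

lemma hasDerivAt_Psi0 {n : ℕ} (a : Iq n ⊕ Iu n) (y : Ysp n) :
    HasDerivAt (fun t => Psi0 (flow a t y)) (A0 a y) 0 := by
  rcases a with a | a
  · exact hasDerivAt_coord_cj y.1 _ (combU n y.2) (Ef_mem n (Sum.inl a))
  · exact hasDerivAt_flow_inr a y (coord n ∘ₗ cj y.1)

lemma hasDerivAt_A0 {n : ℕ} (a b : Iq n ⊕ Iu n) (y : Ysp n) :
    HasDerivAt (fun t => A0 b (flow a t y)) (P0 a b y) 0 := by
  rcases a with a | a
  · exact hasDerivAt_coord_cj y.1 _ (Lb b y.2) (Ef_mem n (Sum.inl a))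
  · rcases b with b | b
    · exact hasDerivAt_flow_inr a y (coord n ∘ₗ cj y.1 ∘ₗ
        { toFun := fun X => ⁅Ef n (Sum.inl b), X⁆
          map_add' := fun X Y => by simp only [Ring.lie_def]; noncomm_ring
          map_smul' := fun c X => by simp [Ring.lie_def, smul_sub] })
    · exact hasDerivAt_const (0 : ℝ) (coord n (cj y.1 (Ef n (Sum.inr b))))

/-- The base point in the orbit of `J`. -/
def xJ {n : ℕ} (y : Ysp n) : Arr n := ent n (cj y.1 (Jnn n))

/-- First derivatives of a perturbation depending on the base point. -/
def B1 {n : ℕ} (f : Arr n → (Iq n ⊕ Iu n → ℝ)) :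
    Iq n ⊕ Iu n → Ysp n → Iq n ⊕ Iu n → ℝ
  | Sum.inl a, y => fderiv ℝ f (xJ y) (ent n <| cj y.1 ⁅Ef n (Sum.inl a), Jnn n⁆)
  | Sum.inr _, _ => 0

/-- Second derivatives of a perturbation depending on the base point. -/
def Q1 {n : ℕ} (f : Arr n → (Iq n ⊕ Iu n → ℝ)) :
    Iq n ⊕ Iu n → Iq n ⊕ Iu n → Ysp n → Iq n ⊕ Iu n → ℝ
  | Sum.inl a, Sum.inl b, y =>
    fderiv ℝ (fderiv ℝ f) (xJ y) (ent n <| cj y.1 ⁅Ef n (Sum.inl a), Jnn n⁆)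
      (ent n <| cj y.1 ⁅Ef n (Sum.inl b), Jnn n⁆) +
    fderiv ℝ f (xJ y) (ent n <| cj y.1 ⁅Ef n (Sum.inl a), ⁅Ef n (Sum.inl b), Jnn n⁆⁆)
  | _, _, _ => 0

lemma continuous_cj_const {n : ℕ} (W : Mat2 n) : Continuous fun y : Ysp n => ent n (cj y.1 W) :=
  (continuous_ent n).comp ((continuous_cj n).comp (continuous_fst.prodMk continuous_const))

lemma hasDerivAt_beta {n : ℕ} {f : Arr n → (Iq n ⊕ Iu n → ℝ)} (hf : ContDiff ℝ 2 f)
    (a : Iq n ⊕ Iu n) (y : Ysp n) :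
    HasDerivAt (fun t => f (xJ (flow a t y))) (B1 f a y) 0 := by
  rcases a with a | a
  · have h1 := hasDerivAt_ent_cj y.1 _ (Jnn n) (Ef_mem n (Sum.inl a))
    have hF : HasFDerivAt f (fderiv ℝ f (xJ y)) (xJ y) :=
      ((hf.differentiable two_ne_zero).differentiableAt (x := xJ y)).hasFDerivAt
    have e : xJ y = ent n (cj (y.1 * expK (Ef n (Sum.inl a)) (Ef_mem n _) 0) (Jnn n)) := by
      rw [expK_zero, mul_one]; rfl
    exact hF.comp_hasDerivAt_of_eq 0 h1 e
  · exact hasDerivAt_const (0 : ℝ) (f (xJ y))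

lemma hasDerivAt_B1 {n : ℕ} {f : Arr n → (Iq n ⊕ Iu n → ℝ)} (hf : ContDiff ℝ 2 f)
    (a b : Iq n ⊕ Iu n) (y : Ysp n) :
    HasDerivAt (fun t => B1 f b (flow a t y)) (Q1 f a b y) 0 := by
  rcases b with b | b
  · rcases a with a | a
    · have h1 := hasDerivAt_ent_cj y.1 _ (Jnn n) (Ef_mem n (Sum.inl a))
      have hf' : Differentiable ℝ (fderiv ℝ f) :=
        (hf.fderiv_right (m := 1) (by norm_num)).differentiable one_ne_zero
      have hF : HasFDerivAt (fderiv ℝ f) (fderiv ℝ (fderiv ℝ f) (xJ y)) (xJ y) :=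
        (hf'.differentiableAt (x := xJ y)).hasFDerivAt
      have e : xJ y = ent n (cj (y.1 * expK (Ef n (Sum.inl a)) (Ef_mem n _) 0) (Jnn n)) := by
        rw [expK_zero, mul_one]; rfl
      have h2 := hF.comp_hasDerivAt_of_eq 0 h1 e
      have h3 := hasDerivAt_ent_cj y.1 _ ⁅Ef n (Sum.inl b), Jnn n⁆ (Ef_mem n (Sum.inl a))
      have h4 := h2.clm_apply h3
      simp only [Function.comp_apply, expK_zero, mul_one] at h4
      exact h4
    · exact hasDerivAt_const (0 : ℝ) (B1 f (Sum.inl b) y)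
  · rcases a with a | a <;> exact hasDerivAt_const _ _

lemma continuous_A0 {n : ℕ} (a : Iq n ⊕ Iu n) : Continuous (A0 (n := n) a) :=
  continuous_coord_cj (continuous_Lb a)

lemma continuous_P0 {n : ℕ} (a b : Iq n ⊕ Iu n) : Continuous (P0 (n := n) a b) := by
  rcases a with a | a
  · exact continuous_coord_cj ((continuous_lie _).comp (continuous_Lb b))
  · rcases b with b | b
    · exact continuous_coord_cj continuous_const
    · exact continuous_const

lemma continuous_B1 {n : ℕ} {f : Arr n → (Iq n ⊕ Iu n → ℝ)} (hf : ContDiff ℝ 2 f)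
    (a : Iq n ⊕ Iu n) : Continuous (B1 f a) := by
  rcases a with a | a
  · exact ((hf.continuous_fderiv two_ne_zero).comp (continuous_cj_const _)).clm_apply
      (continuous_cj_const _)
  · exact continuous_const

lemma continuous_Q1 {n : ℕ} {f : Arr n → (Iq n ⊕ Iu n → ℝ)} (hf : ContDiff ℝ 2 f)
    (a b : Iq n ⊕ Iu n) : Continuous (Q1 f a b) := by
  have hf' : ContDiff ℝ 1 (fderiv ℝ f) := hf.fderiv_right (m := 1) (by norm_num)
  rcases a with a | a
  · rcases b with b | b
    · exact ((((hf'.continuous_fderiv one_ne_zero).comp (continuous_cj_const _)).clm_apply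
        (continuous_cj_const _)).clm_apply (continuous_cj_const _)).add
        (((hf.continuous_fderiv two_ne_zero).comp (continuous_cj_const _)).clm_apply
        (continuous_cj_const _))
    · exact continuous_const
  · exact continuous_const

lemma lie_u_J {n : ℕ} {U : Mat2 n} (hU : U ∈ uSub n) : ⁅U, Jnn n⁆ = 0 := by
  rw [Ring.lie_def, hU.2.2, sub_self]

lemma Q1_symm {n : ℕ} {f : Arr n → (Iq n ⊕ Iu n → ℝ)} (hf : ContDiff ℝ 2 f)
    (a b : Iq n ⊕ Iu n) (y : Ysp n) : Q1 f a b y = Q1 f b a y := by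
  rcases a with a | a <;> rcases b with b | b
  · have hs : IsSymmSndFDerivAt ℝ f (xJ y) :=
      (hf.contDiffAt).isSymmSndFDerivAt (by simp)
    simp only [Q1]
    rw [hs.eq]
    congr 3
    have h := lie_jacobi_ring (Ef n (Sum.inl a)) (Ef n (Sum.inl b)) (Jnn n)
    rw [lie_u_J (lie_q_q (Ef_inl n a) (Ef_inl n b)), zero_add] at h
    rw [h]
  all_goals rfl

lemma frame_anti {n : ℕ} {f : Arr n → (Iq n ⊕ Iu n → ℝ)} (hf : ContDiff ℝ 2 f)
    (y : Ysp n) (τ : ℝ) (a b : Iq n ⊕ Iu n) (w : Iq n ⊕ Iu n → ℝ) :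
    a ≠ b → detRowCM (Iq n ⊕ Iu n) (Function.update (Function.update
      (fun c => A0 c y + τ • B1 f c y) a w) b
        ((P0 a b y + τ • Q1 f a b y) - (P0 b a y + τ • Q1 f b a y))) = 0 := by
  intro hab
  rw [Q1_symm hf a b y, add_sub_add_right_eq_sub]
  have hz : P0 a b y - P0 b a y = 0 → detRowCM (Iq n ⊕ Iu n) (Function.update (Function.update
      (fun c => A0 c y + τ • B1 f c y) a w) b (P0 a b y - P0 b a y)) = 0 := by
    intro h
    rw [h]
    exact ContinuousMultilinearMap.map_coord_zero _ b (by simp)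
  rcases a with a | a <;> rcases b with b | b
  · obtain ⟨ν, hν⟩ := uSub_eq_sum (lie_u_u (lie_q_q (Ef_inl n a) (Ef_inl n b))
      (combU_mem n y.2))
    have h : P0 (Sum.inl a) (Sum.inl b) y - P0 (Sum.inl b) (Sum.inl a) y =
        ∑ c, ν c • (A0 (Sum.inr c) y + τ • B1 f (Sum.inr c) y) := by
      simp only [P0, A0, B1, Lb, Sum.elim_inl, Sum.elim_inr, smul_zero, add_zero]
      rw [← map_sub, ← map_sub]
      have h := lie_jacobi_ring (Ef n (Sum.inl a)) (Ef n (Sum.inl b)) (combU n y.2)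
      rw [h, add_sub_cancel_right, hν, map_sum, map_sum]
      simp only [map_smul]
    rw [h]
    have hsum := (Matrix.detRowAlternating (n := Iq n ⊕ Iu n) (R := ℝ)).map_update_sum
      Finset.univ (Sum.inl b) (fun c => ν c • (A0 (Sum.inr c) y + τ • B1 f (Sum.inr c) y))
      (Function.update (fun c => A0 c y + τ • B1 f c y) (Sum.inl a) w)
    refine hsum.trans (Finset.sum_eq_zero fun c _ => ?_)
    rw [AlternatingMap.map_update_smul]
    have := (Matrix.detRowAlternating (n := Iq n ⊕ Iu n) (R := ℝ)).map_update_self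
      (Function.update (fun c => A0 c y + τ • B1 f c y) (Sum.inl a) w)
      (i := Sum.inl b) (j := Sum.inr c) (by simp)
    rw [Function.update_of_ne (by simp)] at this
    rw [this, smul_zero]
  · exact hz (by simp [P0, Lb])
  · exact hz (by simp [P0, Lb])
  · exact hz (by simp [P0])

lemma Ef_eq_comb (n : ℕ) (i : Iq n ⊕ Iu n) : Ef n i = comb n (Pi.single i 1) := by
  rw [comb_apply, Finset.sum_eq_single i]
  · simp
  · intro b _ hb; simp [hb]
  · simp

/-- The matrix (acting on rows) of conjugation by `k` in the adapted basis. -/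
def AdK {n : ℕ} (k : KSub n) : Matrix (Iq n ⊕ Iu n) (Iq n ⊕ Iu n) ℝ :=
  Matrix.of fun j => coord n (cj k (Ef n j))

lemma coord_cj {n : ℕ} (k : KSub n) {W : Mat2 n} (hW : W ∈ vSub n) :
    coord n (cj k W) = coord n W ᵥ* AdK k := by
  nth_rewrite 1 [← comb_coord hW]
  rw [comb_apply, map_sum, map_sum]
  ext i
  simp only [map_smul, Finset.sum_apply, Pi.smul_apply, smul_eq_mul, Matrix.vecMul, dotProduct,
    AdK, Matrix.of_apply]

lemma AdK_mul {n : ℕ} (k l : KSub n) : AdK (k * l) = AdK l * AdK k := by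
  ext j i
  have h := congrFun (coord_cj k (cj_mem_vSub l (Ef_mem n j))) i
  rw [← cj_mul] at h
  exact h

lemma AdK_one (n : ℕ) : AdK (1 : KSub n) = 1 := by
  ext j i
  change coord n (cj 1 (Ef n j)) i = _
  rw [cj_one, Ef_eq_comb, coord_comb, Matrix.one_apply, Pi.single_apply]
  simp only [eq_comm]

lemma continuous_det_AdK (n : ℕ) : Continuous fun k : KSub n => (AdK k).det := by
  refine Continuous.matrix_det ?_
  refine continuous_matrix fun j i => ?_
  exact (continuous_apply i).comp ((continuous_coord n).comp ((continuous_cj n).comp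
    (continuous_id.prodMk continuous_const)))

lemma det_AdK_expK_pos {n : ℕ} (W : Mat2 n) (h : W ∈ vSub n) (t : ℝ) :
    0 < (AdK (expK W h t)).det := by
  have h1 : (AdK (expK W h t)).det ≠ 0 := by
    have h2 : AdK (expK W h t) * AdK (expK W h t)⁻¹ = 1 := by
      rw [← AdK_mul, inv_mul_cancel, AdK_one]
    intro h3
    have := congrArg Matrix.det h2
    rw [Matrix.det_mul, h3, zero_mul, Matrix.det_one] at this
    exact zero_ne_one this
  have h2 : (AdK (expK W h t)).det = (AdK (expK W h (t / 2))).det ^ 2 := by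
    rw [← add_halves t, expK_add, AdK_mul, Matrix.det_mul, add_halves, sq]
  rw [h2] at h1 ⊢
  positivity

/-- The orientation preserving part of the maximal compact subgroup. -/
def posK (n : ℕ) : Set (Ysp n) := {y | 0 < (AdK y.1).det}

lemma isOpen_posK (n : ℕ) : IsOpen (posK n) :=
  isOpen_lt continuous_const ((continuous_det_AdK n).comp continuous_fst)

lemma flow_preimage_posK {n : ℕ} (a : Iq n ⊕ Iu n) (t : ℝ) : flow a t ⁻¹' posK n = posK n := by
  rcases a with a | a
  · ext y
    change 0 < (AdK (y.1 * expK _ _ t)).det ↔ 0 < (AdK y.1).det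
    rw [AdK_mul, Matrix.det_mul]
    exact mul_pos_iff_of_pos_left (det_AdK_expK_pos _ _ t)
  · rfl

/-- A flow invariant measure on the product. -/
def muY (n : ℕ) : Measure (Ysp n) :=
  ((Measure.haar (G := KSub n)).inv.prod volume).restrict (posK n)

instance (n : ℕ) : IsFiniteMeasureOnCompacts (muY n) := by
  unfold muY; infer_instance

lemma measurePreserving_flow {n : ℕ} (a : Iq n ⊕ Iu n) (t : ℝ) :
    MeasurePreserving (flow a t) (muY n) (muY n) := by
  have key : MeasurePreserving (flow a t) ((Measure.haar (G := KSub n)).inv.prod volume)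
      ((Measure.haar (G := KSub n)).inv.prod volume) := by
    rcases a with a | a
    · exact (measurePreserving_mul_right (Measure.haar (G := KSub n)).inv
        (expK (Ef n (Sum.inl a)) (Ef_mem n _) t)).prod (MeasurePreserving.id _)
    · exact (MeasurePreserving.id _).prod
        (measurePreserving_add_right (volume : Measure (Iu n → ℝ)) (t • Pi.single a 1))
  have h := key.restrict_preimage (isOpen_posK n).measurableSet
  rw [flow_preimage_posK] at h
  exact h

/-- The matrix (acting on rows) of the differential of the unperturbed map at the identity. -/
def Lmat {n : ℕ} (ξ : Iu n → ℝ) : Matrix (Iq n ⊕ Iu n) (Iq n ⊕ Iu n) ℝ :=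
  Matrix.of fun a => coord n (Lb a ξ)

lemma det_A0 {n : ℕ} (y : Ysp n) :
    detRowCM (Iq n ⊕ Iu n) (fun c => A0 c y) = (Lmat y.2).det * (AdK y.1).det := by
  rw [← Matrix.det_mul, detRowCM_apply]
  congr 1
  ext a i
  exact congrFun (coord_cj y.1 (Lb_mem a y.2)) i

lemma comb_vecMul_Lmat {n : ℕ} (ξ : Iu n → ℝ) (v : Iq n ⊕ Iu n → ℝ) :
    comb n (v ᵥ* Lmat ξ) = ⁅∑ a, v (Sum.inl a) • Ef n (Sum.inl a), combU n ξ⁆ +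
      ∑ c, v (Sum.inr c) • Ef n (Sum.inr c) := by
  have h : v ᵥ* Lmat ξ = coord n (∑ a, v a • Lb a ξ) := by
    rw [map_sum]
    ext i
    simp [Matrix.vecMul, dotProduct, Lmat]
  rw [h, comb_coord ((vSub n).sum_mem fun a _ => (vSub n).smul_mem _ (Lb_mem a ξ)),
    Fintype.sum_sum_type]
  congr 1
  simp only [Lb, Sum.elim_inl, Ring.lie_def, Finset.sum_mul, Finset.mul_sum, smul_mul_assoc,
    mul_smul_comm, smul_sub, Finset.sum_sub_distrib]

open scoped ComplexOrder in
lemma eq_zero_of_trace_sq {n : ℕ} {W : Mat2 n} (h : Wᴴ = -W) (h0 : (W * W).trace = 0) : W = 0 := by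
  rw [← Matrix.trace_conjTranspose_mul_self_eq_zero_iff, h, neg_mul, Matrix.trace_neg, h0, neg_zero]

lemma det_path_ne_zero {n : ℕ} (ξ : Iu n → ℝ) (s t : ℝ)
    (hX : ∀ W ∈ qSub n, s • W + t • ⁅W, combU n ξ⁆ = 0 → W = 0) (hst : s + t ≠ 0) :
    (s • (1 : Matrix (Iq n ⊕ Iu n) (Iq n ⊕ Iu n) ℝ) + t • Lmat ξ).det ≠ 0 := by
  intro hdet
  obtain ⟨v, hv0, hv⟩ := Matrix.exists_vecMul_eq_zero_iff.2 hdet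
  apply hv0
  have h1 := congrArg (comb n) hv
  rw [Matrix.vecMul_add, Matrix.vecMul_smul, Matrix.vecMul_smul, Matrix.vecMul_one, map_add,
    map_smul, map_smul, comb_vecMul_Lmat, map_zero, comb_apply, Fintype.sum_sum_type] at h1
  set Vq := ∑ a, v (Sum.inl a) • Ef n (Sum.inl a) with hVq
  set Vu := ∑ a, v (Sum.inr a) • Ef n (Sum.inr a) with hVu
  have mq : Vq ∈ qSub n := (qSub n).sum_mem fun i _ => (qSub n).smul_mem _ (Ef_inl n i)
  have mu : Vu ∈ uSub n := (uSub n).sum_mem fun i _ => (uSub n).smul_mem _ (Ef_inr n i)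
  have h2 : (s • Vq + t • ⁅Vq, combU n ξ⁆) + (s + t) • Vu = 0 := by
    rw [← h1]; module
  have m1 : s • Vq + t • ⁅Vq, combU n ξ⁆ ∈ qSub n := (qSub n).add_mem ((qSub n).smul_mem _ mq)
    ((qSub n).smul_mem _ (lie_q_u mq (combU_mem n ξ)))
  have h3 : s • Vq + t • ⁅Vq, combU n ξ⁆ = 0 := by
    refine Submodule.disjoint_def.1 (disjoint_qSub_uSub n) _ m1 ?_
    rw [eq_neg_of_add_eq_zero_left h2]
    exact (uSub n).neg_mem ((uSub n).smul_mem _ mu)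
  rw [h3, zero_add] at h2
  apply comb_injective n
  rw [comb_apply, Fintype.sum_sum_type, ← hVq, ← hVu, hX _ mq h3,
    (smul_eq_zero.1 h2).resolve_left hst, map_zero, add_zero]

lemma det_Lmat_nonneg {n : ℕ} (ξ : Iu n → ℝ) : 0 ≤ (Lmat ξ).det := by
  by_contra! hneg
  let p : ℝ → ℝ := fun t =>
    ((1 - t) • (1 : Matrix (Iq n ⊕ Iu n) (Iq n ⊕ Iu n) ℝ) + t • Lmat ξ).det
  have cp : Continuous p := by
    refine Continuous.matrix_det (continuous_matrix fun i j => ?_)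
    simp only [Matrix.add_apply, Matrix.smul_apply, smul_eq_mul]
    fun_prop
  have p0 : p 0 = 1 := by simp [p]
  have p1 : p 1 = (Lmat ξ).det := by simp [p]
  obtain ⟨t, ht, ht0⟩ := intermediate_value_Icc' zero_le_one cp.continuousOn
    (show (0 : ℝ) ∈ Set.Icc (p 1) (p 0) by rw [p0, p1]; exact ⟨hneg.le, zero_le_one⟩)
  have ht1 : t ≠ 1 := by rintro rfl; rw [p1] at ht0; exact hneg.ne ht0
  refine det_path_ne_zero ξ (1 - t) t ?_ (by simp) ht0
  intro W hW hW0
  apply eq_zero_of_trace_sq hW.1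
  have h1 : ((⁅W, combU n ξ⁆ : Mat2 n) * W).trace = 0 := by
    rw [Ring.lie_def, sub_mul, Matrix.trace_sub, sub_eq_zero,
      Matrix.trace_mul_cycle W, Matrix.trace_mul_cycle W W]
  have h2 := congrArg (fun M : Mat2 n => (M * W).trace) hW0
  simp only [add_mul, smul_mul_assoc, Matrix.trace_add, Matrix.trace_smul, h1, smul_zero, add_zero,
    zero_mul, Matrix.trace_zero] at h2
  exact (smul_eq_zero.1 h2).resolve_left (sub_ne_zero.2 ht1.symm)

/-- A regular element of `uSub n`. -/
def iJ (n : ℕ) : Mat2 n := Complex.I • Jnn n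

lemma iJ_mem (n : ℕ) : iJ n ∈ uSub n := by
  refine ⟨?_, ?_, ?_⟩
  · simp [iJ, conjTranspose_smul, Jnn_conjTranspose]
  · simp [iJ, transpose_smul, Jnn_transpose, Jnn_mul_Smat]
  · simp [iJ]

lemma exists_combU_eq {n : ℕ} {W : Mat2 n} (h : W ∈ uSub n) : ∃ ξ, combU n ξ = W := by
  obtain ⟨v, hv⟩ := uSub_eq_sum h
  exact ⟨v, by rw [combU_apply, hv]⟩

lemma det_Lmat_pos {n : ℕ} {ξ : Iu n → ℝ} (h : combU n ξ = iJ n) : 0 < (Lmat ξ).det := by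
  refine lt_of_le_of_ne (det_Lmat_nonneg ξ) (Ne.symm ?_)
  have := det_path_ne_zero ξ 0 1 ?_ (by simp)
  · simpa using this
  · intro W hW h0
    rw [zero_smul, zero_add, one_smul, h, iJ, Ring.lie_def, mul_smul_comm, smul_mul_assoc,
      hW.2.2] at h0
    have h1 : (-(2 * Complex.I)) • (Jnn n * W) = 0 := by rw [← h0]; module
    have h2 := (smul_eq_zero.1 h1).resolve_left (by simp)
    calc W = Jnn n * (Jnn n * W) := by rw [← Matrix.mul_assoc, Jnn_sq, one_mul]
      _ = 0 := by rw [h2, mul_zero]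

lemma coord_iJ_eq {n : ℕ} {ξ : Iu n → ℝ} (h : combU n ξ = iJ n) :
    Psi0 ((1, ξ) : Ysp n) = coord n (iJ n) := by
  simp only [Psi0, cj_one, h]

lemma continuous_xJ (n : ℕ) : Continuous (xJ (n := n)) := continuous_cj_const (Jnn n)

lemma continuous_inv_cj {n : ℕ} {X : Type} [TopologicalSpace X] {k : X → KSub n}
    {w : X → (Iq n ⊕ Iu n → ℝ)} (hk : Continuous k) (hw : Continuous w) :
    Continuous fun x => cj (k x)⁻¹ (comb n (w x)) :=
  (continuous_cj n).comp (hk.inv.prodMk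
    ((LinearMap.continuous_of_finiteDimensional (comb n)).comp hw))

lemma inv_cj_Psi0 {n : ℕ} (y : Ysp n) : cj y.1⁻¹ (comb n (Psi0 y)) = combU n y.2 := by
  rw [Psi0, comb_coord (cj_mem_vSub _ (uSub_le_vSub n (combU_mem n _))), cj_inv_cj]

lemma exists_compact_support {n : ℕ} {β : KSub n → (Iq n ⊕ Iu n → ℝ)} (hβ : Continuous β)
    {T : Set (Iq n ⊕ Iu n → ℝ)} (hT : IsCompact T) (τ₀ : ℝ) :
    ∃ C : Set (Ysp n), IsCompact C ∧ ∀ τ, |τ - τ₀| < 1 → ∀ y ∉ C, Psi0 y + τ • β y.1 ∉ T := by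
  let g : KSub n × ℝ × (Iq n ⊕ Iu n → ℝ) → Ysp n := fun p =>
    (p.1, fun c => coord n (cj p.1⁻¹ (comb n (p.2.2 - p.2.1 • β p.1))) (Sum.inr c))
  have hw : Continuous fun p : KSub n × ℝ × (Iq n ⊕ Iu n → ℝ) => p.2.2 - p.2.1 • β p.1 := by
    fun_prop
  have cg : Continuous g := by
    refine continuous_fst.prodMk (continuous_pi fun c => ?_)
    exact (continuous_apply (Sum.inr c)).comp ((continuous_coord n).comp
      (continuous_inv_cj continuous_fst hw))
  refine ⟨g '' (Set.univ ×ˢ Set.Icc (τ₀ - 1) (τ₀ + 1) ×ˢ T),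
    (isCompact_univ.prod (isCompact_Icc.prod hT)).image cg, fun τ hτ y hy hyT => hy ?_⟩
  rw [abs_lt] at hτ
  refine ⟨(y.1, τ, Psi0 y + τ • β y.1), ⟨Set.mem_univ _, ⟨by linarith, by linarith⟩, hyT⟩, ?_⟩
  refine Prod.ext rfl ?_
  funext c
  simp only [g, add_sub_cancel_right]
  rw [inv_cj_Psi0, coord_combU]

lemma exists_large_shift {n : ℕ} {β : KSub n → (Iq n ⊕ Iu n → ℝ)} (hβ : Continuous β)
    (h0 : ∀ k, ⁅cj k⁻¹ (comb n (β k)), Jnn n⁆ ≠ 0)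
    {T : Set (Iq n ⊕ Iu n → ℝ)} (hT : IsCompact T) :
    ∃ τ : ℝ, ∀ y : Ysp n, Psi0 y + τ • β y.1 ∉ T := by
  have hent : ∀ W : Mat2 n, W ≠ 0 → 0 < ‖ent n W‖ := fun W hW => by
    rw [norm_pos_iff]
    intro h
    apply hW
    rw [← ofArr_ent n W, h, map_zero]
  have cbr : Continuous fun W : Mat2 n => ‖ent n ⁅W, Jnn n⁆‖ := by
    refine continuous_norm.comp ((continuous_ent n).comp ?_)
    simp only [Ring.lie_def]; fun_prop
  obtain ⟨k₀, -, hk₀⟩ := (isCompact_univ (X := KSub n)).exists_isMinOn Set.univ_nonempty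
    (cbr.comp (continuous_inv_cj continuous_id hβ)).continuousOn
  have hδ := hent _ (h0 k₀)
  obtain ⟨R, hR⟩ := ((isCompact_univ (X := KSub n)).prod hT).bddAbove_image
    (cbr.comp (continuous_inv_cj continuous_fst continuous_snd)).continuousOn
  set δ := ‖ent n ⁅cj k₀⁻¹ (comb n (β k₀)), Jnn n⁆‖ with hδdef
  refine ⟨(|R| + 1) / δ, fun y hy => ?_⟩
  have h1 : ‖ent n ⁅cj y.1⁻¹ (comb n (Psi0 y + ((|R| + 1) / δ) • β y.1)), Jnn n⁆‖ ≤ R :=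
    hR ⟨(y.1, Psi0 y + ((|R| + 1) / δ) • β y.1), ⟨Set.mem_univ _, hy⟩, rfl⟩
  have h2 : δ ≤ ‖ent n ⁅cj y.1⁻¹ (comb n (β y.1)), Jnn n⁆‖ := hk₀ (Set.mem_univ y.1)
  have h3 : ⁅cj y.1⁻¹ (comb n (Psi0 y + ((|R| + 1) / δ) • β y.1)), Jnn n⁆ =
      ((|R| + 1) / δ) • ⁅cj y.1⁻¹ (comb n (β y.1)), Jnn n⁆ := by
    rw [map_add, map_add, map_smul, map_smul, inv_cj_Psi0]
    have := lie_u_J (combU_mem n y.2)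
    rw [Ring.lie_def] at this ⊢
    rw [Ring.lie_def, add_mul, mul_add, add_sub_add_comm, this, zero_add, smul_mul_assoc,
      mul_smul_comm, smul_sub]
  rw [h3, map_smul, norm_smul, Real.norm_of_nonneg (by positivity)] at h1
  have h4 : (|R| + 1) / δ * δ = |R| + 1 := div_mul_cancel₀ _ hδ.ne'
  have h5 : (|R| + 1) / δ * δ ≤ R := (mul_le_mul_of_nonneg_left h2 (by positivity)).trans h1
  linarith [le_abs_self R]

/-- Smooth hairy ball theorem on the orbit of `J`. -/
lemma exists_zero_of_contDiff {n : ℕ} {f : Arr n → (Iq n ⊕ Iu n → ℝ)} (hf : ContDiff ℝ 2 f) :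
    ∃ k : KSub n, ⁅cj k⁻¹ (comb n (f (ent n (cj k (Jnn n))))), Jnn n⁆ = 0 := by
  by_contra! h0
  obtain ⟨ξ, hξ⟩ := exists_combU_eq (iJ_mem n)
  let χ : ContDiffBump (coord n (iJ n)) := ⟨1, 2, one_pos, one_lt_two⟩
  have hT : IsCompact (tsupport χ) := χ.hasCompactSupport
  have hβ : Continuous fun k : KSub n => f (ent n (cj k (Jnn n))) :=
    hf.continuous.comp ((continuous_ent n).comp
      ((continuous_cj n).comp (continuous_id.prodMk continuous_const)))
  have hχ0 : ∀ v, v ∉ tsupport χ → χ v = 0 := fun v hv => image_eq_zero_of_notMem_tsupport hv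
  have cΨ : Continuous (Psi0 (n := n)) := continuous_coord_cj (continuous_combU n)
  have hsupp : ∀ τ₀ : ℝ, ∃ C : Set (Ysp n), IsCompact C ∧ ∀ τ, |τ - τ₀| < 1 → ∀ y ∉ C,
      χ (Psi0 y + τ • f (xJ y)) = 0 := fun τ₀ => by
    obtain ⟨C, hC, hC'⟩ := exists_compact_support hβ hT τ₀
    exact ⟨C, hC, fun τ hτ y hy => hχ0 _ (hC' τ hτ y hy)⟩
  obtain ⟨τ, hτ⟩ := exists_large_shift hβ h0 hT
  have key := degree_integral_const (muY n) flow continuous_flow flow_zero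
    (fun a s t y => flow_add a s t y) measurePreserving_flow
    cΨ (hf.continuous.comp (continuous_xJ n)) continuous_A0
    (continuous_B1 hf) continuous_P0 (continuous_Q1 hf) hasDerivAt_Psi0 (hasDerivAt_beta hf)
    hasDerivAt_A0 (hasDerivAt_B1 hf) (fun y τ a b hab => frame_anti hf y τ a b _ hab)
    (χ := χ) χ.contDiff hsupp τ
  have hzero : ∀ y : Ysp n, χ (Psi0 y + τ • f (xJ y)) = 0 := fun y => hχ0 _ (hτ y)
  simp only [Function.comp_apply, hzero, zero_mul, integral_zero] at key
  set F : Ysp n → ℝ := fun y => χ (Psi0 y) * detRowCM (Iq n ⊕ Iu n) (fun c => A0 c y) with hF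
  have cF : Continuous F := (χ.continuous.comp cΨ).mul
    ((detRowCM (Iq n ⊕ Iu n)).cont.comp (continuous_pi continuous_A0))
  obtain ⟨C, hC, hC0⟩ := hsupp 0
  have hFC : HasCompactSupport F := HasCompactSupport.intro hC fun y hy => by
    have := hC0 0 (by simp) y hy
    rw [zero_smul, add_zero] at this
    simp only [hF, this, zero_mul]
  have hFpos : ∀ y ∈ posK n, 0 ≤ F y := fun y hy => by
    simp only [hF, det_A0]
    exact mul_nonneg χ.nonneg (mul_nonneg (det_Lmat_nonneg _) (le_of_lt hy))
  have hpos : 0 < ∫ y, F y ∂(muY n) := by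
    have hae : 0 ≤ᵐ[muY n] F := ae_restrict_of_forall_mem (isOpen_posK n).measurableSet hFpos
    rw [integral_pos_iff_support_of_nonneg_ae hae
      (cF.integrable_of_hasCompactSupport hFC)]
    rw [muY, Measure.restrict_apply' (isOpen_posK n).measurableSet]
    have hopen : IsOpen (Function.support F ∩ posK n) :=
      cF.isOpen_support.inter (isOpen_posK n)
    refine hopen.measure_pos _ ⟨(1, ξ), ?_, ?_⟩
    · change F (1, ξ) ≠ 0
      simp only [hF, det_A0, AdK_one, coord_iJ_eq hξ, Matrix.det_one, mul_one]
      rw [χ.one_of_mem_closedBall (Metric.mem_closedBall_self χ.rIn_pos.le), one_mul]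
      exact (det_Lmat_pos hξ).ne'
    · change 0 < (AdK (1 : KSub n)).det
      rw [AdK_one, Matrix.det_one]; exact one_pos
  exact hpos.ne key

lemma exists_contDiff_dist_lt {E F : Type} [NormedAddCommGroup E] [NormedSpace ℝ E]
    [FiniteDimensional ℝ E] [NormedAddCommGroup F] [NormedSpace ℝ F] [CompleteSpace F]
    (f : C(E, F)) {K : Set E} (hK : IsCompact K) {ε : ℝ} (hε : 0 < ε) :
    ∃ g : E → F, ContDiff ℝ 2 g ∧ ∀ x ∈ K, dist (f x) (g x) < ε := by
  have h := ContinuousMap.dense_setOfPred_contDiff (E := E) (F := F) f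
  rw [mem_closure_iff_nhds_basis
    (nhds_basis_uniformity Metric.uniformity_basis_dist.compactConvergenceUniformity)] at h
  obtain ⟨g, hg, hg'⟩ := h (K, ε) ⟨hK, hε⟩
  have hg2 : ContDiff ℝ ((⊤ : ℕ∞) : WithTop ℕ∞) g := hg
  refine ⟨g, contDiff_infty.1 hg2 2, fun x hx => ?_⟩
  rw [dist_comm]
  exact hg' x hx

lemma exists_zero_of_continuous {n : ℕ} {β : KSub n → (Iq n ⊕ Iu n → ℝ)} (hβ : Continuous β)
    (hinv : ∀ k l, cj k (Jnn n) = cj l (Jnn n) → β k = β l) :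
    ∃ k : KSub n, ⁅cj k⁻¹ (comb n (β k)), Jnn n⁆ = 0 := by
  by_contra! h0
  have hent : ∀ W : Mat2 n, W ≠ 0 → 0 < ‖ent n W‖ := fun W hW => by
    rw [norm_pos_iff]
    intro h
    apply hW
    rw [← ofArr_ent n W, h, map_zero]
  have cbr : Continuous fun W : Mat2 n => ‖ent n ⁅W, Jnn n⁆‖ := by
    refine continuous_norm.comp ((continuous_ent n).comp ?_)
    simp only [Ring.lie_def]; fun_prop
  obtain ⟨k₀, -, hk₀⟩ := (isCompact_univ (X := KSub n)).exists_isMinOn Set.univ_nonempty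
    (cbr.comp (continuous_inv_cj continuous_id hβ)).continuousOn
  have hδ := hent _ (h0 k₀)
  set δ := ‖ent n ⁅cj k₀⁻¹ (comb n (β k₀)), Jnn n⁆‖ with hδdef
  obtain ⟨R, hR⟩ := ((isCompact_univ (X := KSub n)).prod
    (isCompact_closedBall (0 : Iq n ⊕ Iu n → ℝ) 1)).bddAbove_image
    (cbr.comp (continuous_inv_cj continuous_fst continuous_snd)).continuousOn
  set φ : KSub n → Arr n := fun k => ent n (cj k (Jnn n)) with hφ
  have cφ : Continuous φ := (continuous_ent n).comp
      ((continuous_cj n).comp (continuous_id.prodMk continuous_const))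
  have hF : IsCompact (Set.range φ) := isCompact_range cφ
  have cφ' : Continuous (Set.rangeFactorization φ) := cφ.subtype_mk _
  let Φ : C(KSub n, Set.range φ) := ⟨Set.rangeFactorization φ, cφ'⟩
  have hq : IsQuotientMap Φ :=
    cφ'.isClosedMap.isQuotientMap cφ' Set.rangeFactorization_surjective
  have hfac : Function.FactorsThrough (⟨β, hβ⟩ : C(KSub n, Iq n ⊕ Iu n → ℝ)) Φ := by
    intro k l h
    refine hinv k l ?_
    have h1 : φ k = φ l := congrArg Subtype.val h
    rw [← ofArr_ent n (cj k (Jnn n)), ← ofArr_ent n (cj l (Jnn n))]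
    exact congrArg (ofArr n) h1
  let f0 : C(Set.range φ, Iq n ⊕ Iu n → ℝ) := hq.lift ⟨β, hβ⟩ hfac
  obtain ⟨f, hf⟩ := ContinuousMap.exists_restrict_eq hF.isClosed f0
  have hfβ : ∀ k, f (φ k) = β k := fun k => by
    have h1 : f (φ k) = f0 (Set.rangeFactorization φ k) := by rw [← hf]; rfl
    rw [h1]
    exact DFunLike.congr_fun (hq.lift_comp ⟨β, hβ⟩ hfac) k
  set ε := δ / (2 * (|R| + 1)) with hε
  have hεpos : 0 < ε := by positivity
  obtain ⟨g, hg, hgf⟩ := exists_contDiff_dist_lt f hF hεpos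
  obtain ⟨k, hk⟩ := exists_zero_of_contDiff hg
  have h1 : dist (β k) (g (φ k)) < ε := by rw [← hfβ]; exact hgf _ ⟨k, rfl⟩
  set v := ε⁻¹ • (β k - g (φ k)) with hv
  have h2 : ‖ent n ⁅cj k⁻¹ (comb n v), Jnn n⁆‖ ≤ R := by
    refine hR ⟨(k, v), ⟨Set.mem_univ _, ?_⟩, rfl⟩
    rw [mem_closedBall_zero_iff, hv, norm_smul, norm_inv, Real.norm_of_nonneg hεpos.le,
      ← dist_eq_norm, inv_mul_le_iff₀ hεpos, mul_one]
    exact h1.le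
  have h3 : ⁅cj k⁻¹ (comb n v), Jnn n⁆ = ε⁻¹ • ⁅cj k⁻¹ (comb n (β k)), Jnn n⁆ := by
    have hk' : ⁅cj k⁻¹ (comb n (g (φ k))), Jnn n⁆ = 0 := hk
    rw [hv, map_smul, map_smul, map_sub, map_sub]
    rw [Ring.lie_def] at hk' ⊢
    rw [Ring.lie_def, smul_mul_assoc, mul_smul_comm, ← smul_sub, sub_mul, mul_sub, sub_sub_sub_comm,
      hk', sub_zero]
  rw [h3, map_smul, norm_smul, norm_inv, Real.norm_of_nonneg hεpos.le,
    inv_mul_le_iff₀ hεpos] at h2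
  have h4 : δ ≤ ‖ent n ⁅cj k⁻¹ (comb n (β k)), Jnn n⁆‖ := hk₀ (Set.mem_univ k)
  have h5 : ε * (2 * (|R| + 1)) = δ := div_mul_cancel₀ _ (by positivity)
  nlinarith [le_abs_self R, abs_nonneg R]

/-- The orthogonal projection onto `vSub n`. -/
def projV {n : ℕ} (W : Mat2 n) : Mat2 n :=
  (1 / 4 : ℝ) • ((W - Wᴴ) - Smat n * (W - Wᴴ)ᵀ * Smat n)

lemma continuous_projV (n : ℕ) : Continuous (projV (n := n)) := by
  unfold projV; fun_prop

lemma projV_mem {n : ℕ} (W : Mat2 n) : projV W ∈ vSub n := by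
  refine (vSub n).smul_mem _ ?_
  have hU : (W - Wᴴ)ᴴ = -(W - Wᴴ) := by simp
  generalize W - Wᴴ = U at hU
  have hU' : Uᵀᴴ = -Uᵀ := by
    rw [conjTranspose, ← conjTranspose, conjTranspose, transpose_transpose]
    have := congrArg transpose hU
    rw [conjTranspose, transpose_neg] at this
    simpa [Matrix.transpose_map] using this
  refine ⟨?_, ?_⟩
  · simp only [conjTranspose_sub, conjTranspose_mul, Smat_conjTranspose, hU, hU']
    noncomm_ring
  · rw [transpose_sub, transpose_mul, transpose_mul, transpose_transpose, Smat_transpose]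
    have h1 : Smat n * (U * Smat n) * Smat n = Smat n * U := by
      rw [Matrix.mul_assoc, Matrix.mul_assoc, Smat_sq, mul_one]
    have h2 : Smat n * (Smat n * Uᵀ * Smat n) = Uᵀ * Smat n := by
      rw [← Matrix.mul_assoc, ← Matrix.mul_assoc, Smat_sq, one_mul]
    rw [sub_mul, mul_sub, h1, h2, neg_sub]

lemma trace_mul_projV {n : ℕ} {v : Mat2 n} (hv : v ∈ vSub n) (W : Mat2 n) :
    (v * projV W).trace.re = (v * W).trace.re := by
  have h1 : (v * Wᴴ).trace.re = -(v * W).trace.re := by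
    have : (v * Wᴴ).trace = -star (v * W).trace := by
      rw [← Matrix.trace_conjTranspose, conjTranspose_mul, hv.1, mul_neg, Matrix.trace_neg, neg_neg,
        Matrix.trace_mul_comm]
    rw [this]; simp
  have h2 : ∀ U : Mat2 n, (v * (Smat n * Uᵀ * Smat n)).trace = -(v * U).trace := fun U => by
    calc (v * (Smat n * Uᵀ * Smat n)).trace
        = (v * (Smat n * Uᵀ * Smat n))ᵀ.trace := (Matrix.trace_transpose _).symm
      _ = (Smat n * (U * (Smat n * vᵀ))).trace := by
        simp only [transpose_mul, transpose_transpose, Smat_transpose, Matrix.mul_assoc]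
      _ = (U * (Smat n * (vᵀ * Smat n))).trace := by
        rw [Matrix.trace_mul_comm]; simp only [Matrix.mul_assoc]
      _ = -(v * U).trace := by
        rw [hv.2, mul_neg, ← Matrix.mul_assoc (Smat n), Smat_sq, one_mul, mul_neg, Matrix.trace_neg,
          Matrix.trace_mul_comm]
  have h3 : (v * projV W).trace = (1 / 4 : ℝ) • (2 * ((v * W).trace - (v * Wᴴ).trace)) := by
    rw [projV, mul_smul_comm, Matrix.trace_smul, mul_sub, Matrix.trace_sub, h2, mul_sub,
      Matrix.trace_sub]
    congr 1; ring
  rw [h3]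
  simp [h1]
  ring

/-- Continuous hairy ball theorem on the orbit of `J`, in trace form. -/
lemma exists_trace_eq_zero {n : ℕ} {B : KSub n → Mat2 n} (hB : Continuous B)
    (hinv : ∀ k l, cj k (Jnn n) = cj l (Jnn n) → B k = B l) :
    ∃ k : KSub n, ∀ Y : Mat2 n, Yᴴ = Y → Yᵀ * Smat n = -(Smat n * Y) → Y * Jnn n = -(Jnn n * Y) →
      (Y * ((kmat k)ᴴ * B k * kmat k)).trace.re = 0 := by
  obtain ⟨k, hk⟩ := exists_zero_of_continuous
    (β := fun k => coord n (projV (Complex.I • B k)))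
    ((continuous_coord n).comp ((continuous_projV n).comp
      (by fun_prop : Continuous fun k => Complex.I • B k)))
    (fun k l h => by rw [hinv k l h])
  refine ⟨k, fun Y h1 h2 h3 => ?_⟩
  simp only [comb_coord (projV_mem _)] at hk
  have hv : Complex.I • Y ∈ qSub n := by
    refine ⟨?_, ?_, ?_⟩
    · rw [conjTranspose_smul, h1]; simp
    · rw [transpose_smul, smul_mul_assoc, h2, mul_smul_comm, smul_neg]
    · rw [smul_mul_assoc, h3, mul_smul_comm, smul_neg]
  set v := Complex.I • Y with hvdef
  set Z := cj k⁻¹ (projV (Complex.I • B k)) with hZ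
  have hcomm : Z * Jnn n = Jnn n * Z := by rwa [Ring.lie_def, sub_eq_zero] at hk
  have h4 : (v * Z).trace = 0 := by
    have h5 : (v * Z).trace = -(v * Z).trace := by
      calc (v * Z).trace = (v * Z * (Jnn n * Jnn n)).trace := by rw [Jnn_sq, mul_one]
        _ = (v * (Z * Jnn n) * Jnn n).trace := by simp only [Matrix.mul_assoc]
        _ = (Jnn n * (v * (Jnn n * Z))).trace := by rw [hcomm, Matrix.trace_mul_comm]
        _ = -(v * Jnn n * (Jnn n * Z)).trace := by
          rw [hv.2.2, neg_mul, Matrix.trace_neg, neg_neg]; simp only [Matrix.mul_assoc]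
        _ = -(v * Z).trace := by
          rw [Matrix.mul_assoc, ← Matrix.mul_assoc (Jnn n), Jnn_sq, one_mul]
    linear_combination (1 / 2 : ℂ) * h5
  have h6 : (v * Z).trace = (cj k v * projV (Complex.I • B k)).trace := by
    rw [hZ, cj_apply, cj_apply, kmat_inv, conjTranspose_conjTranspose, ← Matrix.mul_assoc,
      ← Matrix.mul_assoc, Matrix.trace_mul_comm]
    simp only [Matrix.mul_assoc]
  have h7 := trace_mul_projV (cj_mem_vSub k (qSub_le_vSub n hv)) (Complex.I • B k)
  rw [← h6, h4, cj_apply, hvdef] at h7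
  have h8 : (kmat k * (Complex.I • Y) * (kmat k)ᴴ * (Complex.I • B k)).trace =
      -(Y * ((kmat k)ᴴ * B k * kmat k)).trace := by
    rw [mul_smul_comm, mul_smul_comm, smul_mul_assoc, smul_mul_assoc, smul_smul, Complex.I_mul_I,
      neg_one_smul, Matrix.trace_neg, Matrix.mul_assoc, Matrix.mul_assoc, Matrix.trace_mul_comm]
    simp only [Matrix.mul_assoc]
  rw [h8] at h7
  simpa using h7.symm

/-- The underlying matrix of an element of `SOevenC n`. -/
def gm {n : ℕ} (g : SOevenC n) : Mat2 n := g.val.val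

lemma gm_mul {n : ℕ} (g h : SOevenC n) : gm (g * h) = gm g * gm h := rfl

lemma gm_one (n : ℕ) : gm (1 : SOevenC n) = 1 := rfl

lemma gm_S {n : ℕ} (g : SOevenC n) : (gm g)ᵀ * Smat n * gm g = Smat n := g.2.1

lemma gm_mul_inv {n : ℕ} (g : SOevenC n) : gm g * gm g⁻¹ = 1 := by
  rw [← gm_mul, mul_inv_cancel, gm_one]

lemma gm_inv_mul {n : ℕ} (g : SOevenC n) : gm g⁻¹ * gm g = 1 := by
  rw [← gm_mul, inv_mul_cancel, gm_one]

lemma gm_inv {n : ℕ} (g : SOevenC n) : gm g⁻¹ = Smat n * (gm g)ᵀ * Smat n := by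
  have h1 : Smat n * (gm g)ᵀ * Smat n * gm g = 1 := by
    rw [Matrix.mul_assoc, Matrix.mul_assoc, ← Matrix.mul_assoc _ _ (gm g), gm_S, Smat_sq]
  calc gm g⁻¹ = Smat n * (gm g)ᵀ * Smat n * gm g * gm g⁻¹ := by rw [h1, one_mul]
    _ = _ := by rw [Matrix.mul_assoc, gm_mul_inv, mul_one]

lemma continuous_gm (n : ℕ) : Continuous (gm (n := n)) :=
  Units.continuous_val.comp continuous_subtype_val

/-- Build an element of `SOevenC n` from a matrix. -/
def mkG {n : ℕ} (A : Mat2 n) (h1 : Aᵀ * Smat n * A = Smat n) (h2 : A.det = 1) : SOevenC n :=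
  have e : Smat n * Aᵀ * Smat n * A = 1 := by
    rw [Matrix.mul_assoc, Matrix.mul_assoc, ← Matrix.mul_assoc _ _ A, h1, Smat_sq]
  ⟨⟨A, Smat n * Aᵀ * Smat n, mul_eq_one_comm.1 e, e⟩, h1, h2⟩

lemma gm_mkG {n : ℕ} (A : Mat2 n) (h1 h2) : gm (mkG A h1 h2) = A := rfl

lemma gm_injective (n : ℕ) : Function.Injective (gm (n := n)) := fun _ _ h =>
  Subtype.ext (Units.ext h)

lemma continuous_mkG {n : ℕ} {X : Type} [TopologicalSpace X] {A : X → Mat2 n} (hA : Continuous A)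
    (h1 : ∀ x, (A x)ᵀ * Smat n * A x = Smat n) (h2 : ∀ x, (A x).det = 1) :
    Continuous fun x => mkG (A x) (h1 x) (h2 x) := by
  refine Continuous.subtype_mk ?_ _
  refine Units.continuous_iff.2 ⟨?_, ?_⟩
  · exact hA
  · change Continuous fun x => Smat n * (A x)ᵀ * Smat n
    fun_prop

/-- Elements with entries bounded by `r`. -/
def boxG (n : ℕ) (r : ℝ) : Set (SOevenC n) := {g | ∀ i j, ‖gm g i j‖ ≤ r}

lemma isCompact_boxG (n : ℕ) (r : ℝ) : IsCompact (boxG n r) := by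
  let Z : Set (Mat2 n) := {A | Aᵀ * Smat n * A = Smat n ∧ A.det = 1 ∧ ∀ i j, ‖A i j‖ ≤ r}
  have hc : IsClosed Z := by
    refine IsClosed.inter ?_ (IsClosed.inter ?_ ?_)
    · exact isClosed_eq (by fun_prop) continuous_const
    · exact isClosed_eq (Continuous.matrix_det continuous_id) continuous_const
    · have h : {A : Mat2 n | ∀ i j, ‖A i j‖ ≤ r} = ⋂ i, ⋂ j, {A | ‖A i j‖ ≤ r} := by
        ext; simp
      change IsClosed {A : Mat2 n | ∀ i j, ‖A i j‖ ≤ r}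
      rw [h]
      refine isClosed_iInter fun i => isClosed_iInter fun j => ?_
      exact isClosed_le (continuous_norm.comp (continuous_id.matrix_elem i j)) continuous_const
  have hb : IsCompact (Set.univ.pi fun _ => Set.univ.pi fun _ => Metric.closedBall (0 : ℂ) r :
      Set (Arr n)) :=
    isCompact_univ_pi fun _ => isCompact_univ_pi fun _ => isCompact_closedBall _ _
  have hZ : IsCompact Z := by
    refine IsCompact.of_isClosed_subset (X := Mat2 n) hb hc fun A hA => ?_
    exact fun i _ j _ => mem_closedBall_zero_iff.2 (hA.2.2 i j)
  have : CompactSpace Z := isCompact_iff_compactSpace.1 hZ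
  have himg := isCompact_range (continuous_mkG (X := Z) (A := Subtype.val) continuous_subtype_val
    (fun x => x.2.1) (fun x => x.2.2.1))
  convert himg
  ext g
  constructor
  · intro hg
    exact ⟨⟨gm g, gm_S g, g.2.2, hg⟩, gm_injective n rfl⟩
  · rintro ⟨x, rfl⟩
    exact x.2.2.2

/-- Elements with entries strictly bounded by `r`. -/
def oboxG (n : ℕ) (r : ℝ) : Set (SOevenC n) := {g | ∀ i j, ‖gm g i j‖ < r}

lemma isOpen_oboxG (n : ℕ) (r : ℝ) : IsOpen (oboxG n r) := by
  simp only [oboxG, Set.ofPred_forall]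
  refine isOpen_iInter_of_finite fun i => isOpen_iInter_of_finite fun j => ?_
  exact isOpen_lt (continuous_norm.comp ((continuous_gm n).matrix_elem i j)) continuous_const

lemma exists_mem_oboxG {n : ℕ} (g : SOevenC n) : ∃ r : ℕ, g ∈ oboxG n r := by
  obtain ⟨r, hr⟩ := exists_nat_gt (∑ i, ∑ j, ‖gm g i j‖)
  refine ⟨r, fun i j => lt_of_le_of_lt ?_ hr⟩
  exact (Finset.single_le_sum (f := fun j => ‖gm g i j‖) (fun _ _ => norm_nonneg _)
    (Finset.mem_univ j)).trans (Finset.single_le_sum (f := fun i => ∑ j, ‖gm g i j‖)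
      (fun _ _ => Finset.sum_nonneg fun _ _ => norm_nonneg _) (Finset.mem_univ i))

instance locallyCompactSpace_SOevenC (n : ℕ) : LocallyCompactSpace (SOevenC n) := by
  obtain ⟨r, hr⟩ := exists_mem_oboxG (1 : SOevenC n)
  refine (isCompact_boxG n r).locallyCompactSpace_of_mem_nhds_of_group (x := 1) ?_
  exact Filter.mem_of_superset ((isOpen_oboxG n r).mem_nhds hr) fun g hg i j => (hg i j).le

lemma mem_SOstar {n : ℕ} {g : SOevenC n} : g ∈ SOstar n ↔ (gm g)ᴴ * Jnn n * gm g = Jnn n := Iff.rfl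

lemma isClosed_SOstar (n : ℕ) : IsClosed (SOstar n : Set (SOevenC n)) := by
  have h : (SOstar n : Set (SOevenC n)) = {g | (gm g)ᴴ * Jnn n * gm g = Jnn n} := rfl
  rw [h]
  have := continuous_gm n
  exact isClosed_eq (by fun_prop) continuous_const

instance t2Space_quotient (n : ℕ) : T2Space (SOevenC n ⧸ SOstar n) := by
  rw [t2Space_iff_of_isOpenQuotientMap
    (QuotientGroup.isOpenQuotientMap_mk (N := SOstar n))]
  have h : {q : SOevenC n × SOevenC n | (q.1 : SOevenC n ⧸ SOstar n) = q.2} =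
      (fun q : SOevenC n × SOevenC n => q.1⁻¹ * q.2) ⁻¹' (SOstar n : Set (SOevenC n)) := by
    ext q
    exact QuotientGroup.eq
  rw [h]
  exact (isClosed_SOstar n).preimage (by fun_prop)

/-- The inclusion of the maximal compact subgroup. -/
def kG {n : ℕ} (k : KSub n) : SOevenC n := mkG (kmat k) (kmat_S k) (kmat_det k)

lemma gm_kG {n : ℕ} (k : KSub n) : gm (kG k) = kmat k := rfl

lemma gm_kG_inv {n : ℕ} (k : KSub n) : gm (kG k)⁻¹ = (kmat k)ᴴ := by
  calc gm (kG k)⁻¹ = (kmat k)ᴴ * kmat k * gm (kG k)⁻¹ := by rw [kmat_star_mul, one_mul]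
    _ = (kmat k)ᴴ * (gm (kG k) * gm (kG k)⁻¹) := by rw [gm_kG, Matrix.mul_assoc]
    _ = _ := by rw [gm_mul_inv, mul_one]

lemma continuous_kG (n : ℕ) : Continuous (kG (n := n)) :=
  continuous_mkG (continuous_kmat n) kmat_S kmat_det

lemma kG_inv_mul_mem {n : ℕ} {k l : KSub n} (h : cj k (Jnn n) = cj l (Jnn n)) :
    (kG k)⁻¹ * kG l ∈ SOstar n := by
  rw [mem_SOstar, gm_mul, gm_kG_inv, gm_kG, conjTranspose_mul, conjTranspose_conjTranspose]
  rw [cj_apply, cj_apply] at h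
  calc (kmat l)ᴴ * kmat k * Jnn n * ((kmat k)ᴴ * kmat l)
      = (kmat l)ᴴ * (kmat k * Jnn n * (kmat k)ᴴ) * kmat l := by simp only [Matrix.mul_assoc]
    _ = ((kmat l)ᴴ * kmat l) * Jnn n * ((kmat l)ᴴ * kmat l) := by
      rw [h]; simp only [Matrix.mul_assoc]
    _ = Jnn n := by rw [kmat_star_mul, one_mul, mul_one]

lemma exists_mem_SOstar_large {n : ℕ} (hn : 2 ≤ n) (m : ℝ) :
    ∃ g ∈ SOstar n, ∃ i j, m < ‖gm g i j‖ := by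
  let i0 : Fin n := ⟨0, by omega⟩
  let i1 : Fin n := ⟨1, by omega⟩
  have h01 : i0 ≠ i1 := by simp [i0, i1]
  let C : Matrix (Fin n) (Fin n) ℂ := Matrix.single i0 i1 1 - Matrix.single i1 i0 1
  have hCt : Cᵀ = -C := by simp [C]
  have hCh : Cᴴ = -C := by simp [C]
  have hC2 : C * C = -(Matrix.single i0 i0 1 + Matrix.single i1 i1 1) := by
    simp only [C, mul_sub, sub_mul, Matrix.single_mul_single_same,
      Matrix.single_mul_single_of_ne _ _ _ _ h01.symm, Matrix.single_mul_single_of_ne _ _ _ _ h01]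
    simp; abel
  have hC3 : C * C * C = -C := by
    rw [hC2]
    simp only [C, mul_sub, neg_mul, add_mul, Matrix.single_mul_single_same,
      Matrix.single_mul_single_of_ne _ _ _ _ h01.symm, Matrix.single_mul_single_of_ne _ _ _ _ h01]
    simp
    abel
  let Y : Mat2 n := Matrix.fromBlocks 0 C (-C) 0
  have hYt : Yᵀ = Y := by simp [Y, Matrix.fromBlocks_transpose, hCt]
  have hYh : Yᴴ = Y := by simp [Y, Matrix.fromBlocks_conjTranspose, hCh]
  have hY2 : Y * Y = Matrix.fromBlocks (-(C * C)) 0 0 (-(C * C)) := by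
    simp [Y, Matrix.fromBlocks_multiply]
  have hY3 : Y * Y * Y = Y := by
    rw [hY2]; simp [Y, Matrix.fromBlocks_multiply, hC3]
  have hYS : Y * Smat n = -(Smat n * Y) := by
    simp [Y, Smat, Matrix.fromBlocks_multiply, Matrix.fromBlocks_neg]
  have hYJ : Y * Jnn n = -(Jnn n * Y) := by
    simp [Y, Jnn_eq, Matrix.fromBlocks_multiply, Matrix.fromBlocks_neg]
  let b : ℝ := |m|
  let a : ℝ := √(1 + b ^ 2)
  have hab : a ^ 2 - b ^ 2 = 1 := by
    have : a ^ 2 = 1 + b ^ 2 := Real.sq_sqrt (by positivity)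
    linarith
  let A : Mat2 n := 1 + (a - 1) • (Y * Y) + b • Y
  have hAt : Aᵀ = A := by
    simp only [A, transpose_add, transpose_one, transpose_smul, transpose_mul, hYt]
  have hAh : Aᴴ = A := by
    simp only [A, conjTranspose_add, conjTranspose_one, conjTranspose_smul, conjTranspose_mul, hYh,
      star_trivial]
  have hY4 : Y * Y * (Y * Y) = Y * Y := by rw [← Matrix.mul_assoc, hY3]
  have hY3' : Y * (Y * Y) = Y := by rw [← Matrix.mul_assoc, hY3]
  have key : ∀ T : Mat2 n, Y * T = -(T * Y) → A * T * A = T := by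
    intro T hT
    have hYYT : Y * Y * T = T * (Y * Y) := by
      rw [Matrix.mul_assoc, hT, mul_neg, ← Matrix.mul_assoc, hT, neg_mul, neg_neg, Matrix.mul_assoc]
    have h1 : A * T = T * (1 + (a - 1) • (Y * Y) - b • Y) := by
      simp only [A, add_mul, mul_add, mul_sub, smul_mul_assoc, mul_smul_comm, hYYT, hT, smul_neg,
        one_mul, mul_one]
      abel
    have h2 : (1 + (a - 1) • (Y * Y) - b • Y) * A = 1 := by
      simp only [A, add_mul, sub_mul, mul_add, smul_mul_assoc, mul_smul_comm, one_mul, mul_one, hY4,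
        hY3, hY3']
      have h3 : (a - 1) + (a - 1) + (a - 1) * (a - 1) - b * b = 0 := by linarith
      have h4 : 1 + ((a - 1) + (a - 1) + (a - 1) * (a - 1) - b * b) • (Y * Y) = 1 := by
        rw [h3, zero_smul, add_zero]
      refine Eq.trans ?_ h4
      module
    rw [h1, Matrix.mul_assoc, h2, mul_one]
  have hdet : A.det * A.det = 1 := by
    have h1 := congrArg Matrix.det (key (Smat n) hYS)
    rw [Matrix.det_mul, Matrix.det_mul] at h1
    have h2 := congrArg Matrix.det (Smat_sq n)
    rw [Matrix.det_mul, Matrix.det_one] at h2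
    linear_combination (Smat n).det * h1 + (1 - A.det * A.det) * h2
  have hent : (A * A) (Sum.inl i0) (Sum.inl i0) = ((a ^ 2 + b ^ 2 : ℝ) : ℂ) := by
    have h1 : A * A = 1 + (a ^ 2 + b ^ 2 - 1) • (Y * Y) + (2 * a * b) • Y := by
      simp only [A, add_mul, mul_add, smul_mul_assoc, mul_smul_comm, one_mul, mul_one, hY4,
        hY3, hY3']
      module
    rw [h1, hY2, hC2]
    simp [Y, h01.symm]
  refine ⟨mkG (A * A) ?_ (by rw [Matrix.det_mul, hdet]), ?_, Sum.inl i0, Sum.inl i0, ?_⟩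
  · rw [transpose_mul, hAt]
    calc A * A * Smat n * (A * A) = A * (A * Smat n * A) * A := by simp only [Matrix.mul_assoc]
      _ = Smat n := by rw [key _ hYS, key _ hYS]
  · rw [mem_SOstar, gm_mkG, conjTranspose_mul, hAh]
    calc A * A * Jnn n * (A * A) = A * (A * Jnn n * A) * A := by simp only [Matrix.mul_assoc]
      _ = Jnn n := by rw [key _ hYJ, key _ hYJ]
  · rw [gm_mkG, hent, Complex.norm_real, Real.norm_of_nonneg (by positivity)]
    have : b = |m| := rfl
    nlinarith [le_abs_self m, sq_nonneg (b - 1)]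

instance continuousConstSMul_quotient {n : ℕ} (Γ : Subgroup (SOevenC n)) :
    ContinuousConstSMul Γ (SOevenC n ⧸ SOstar n) :=
  ⟨fun γ => continuous_const_smul (γ : SOevenC n)⟩

lemma smul_quotient_mk {n : ℕ} (Γ : Subgroup (SOevenC n)) (γ : Γ) (g : SOevenC n) :
    γ • (g : SOevenC n ⧸ SOstar n) = ((γ * g : SOevenC n) : SOevenC n ⧸ SOstar n) := rfl

lemma directed_oboxG (n : ℕ) : Directed (· ⊆ ·) fun r : ℕ => oboxG n r :=
  Monotone.directed_le fun _ _ h _ hg i j => (hg i j).trans_le (Nat.cast_le.2 h)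

lemma oboxG_subset_boxG (n : ℕ) (r : ℝ) : oboxG n r ⊆ boxG n r := fun _ hg i j => (hg i j).le

lemma exists_subset_boxG {n : ℕ} {W : Set (SOevenC n)} (hW : IsCompact W) :
    ∃ r : ℕ, W ⊆ boxG n r := by
  obtain ⟨r, hr⟩ := hW.elim_directed_cover (fun r : ℕ => oboxG n r) (fun r => isOpen_oboxG n r)
    (fun g _ => Set.mem_iUnion.2 (exists_mem_oboxG g)) (directed_oboxG n)
  exact ⟨r, hr.trans (oboxG_subset_boxG n r)⟩

/-- A cocompact action admits a compact set of representatives. -/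
lemma exists_boxG_decomposition {n : ℕ} (Γ : Subgroup (SOevenC n))
    [CompactSpace (MulAction.orbitRel.Quotient Γ (SOevenC n ⧸ SOstar n))] :
    ∃ r : ℕ, ∀ g : SOevenC n, ∃ γ ∈ Γ, ∃ c ∈ boxG n r, ∃ h ∈ SOstar n, g = γ * c * h := by
  let p : SOevenC n → MulAction.orbitRel.Quotient Γ (SOevenC n ⧸ SOstar n) := fun g =>
    Quotient.mk'' (g : SOevenC n ⧸ SOstar n)
  have hp : IsOpenMap p := (isOpenMap_quotient_mk'_mul (Γ := Γ)).comp QuotientGroup.isOpenMap_coe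
  have hsurj : Function.Surjective p := Quotient.mk''_surjective.comp QuotientGroup.mk_surjective
  obtain ⟨r, hr⟩ := isCompact_univ.elim_directed_cover (fun r : ℕ => p '' oboxG n r)
    (fun r => hp _ (isOpen_oboxG n r)) (fun x _ => by
      obtain ⟨g, rfl⟩ := hsurj x
      obtain ⟨r, hr⟩ := exists_mem_oboxG g
      exact Set.mem_iUnion.2 ⟨r, g, hr, rfl⟩)
    ((directed_oboxG n).mono_comp (g := fun s => p '' s) _ fun _ _ h => Set.image_mono h)
  refine ⟨r, fun g => ?_⟩
  obtain ⟨c, hc, hcg⟩ := hr (Set.mem_univ (p g))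
  have h1 : (g : SOevenC n ⧸ SOstar n) ∈ MulAction.orbit Γ (c : SOevenC n ⧸ SOstar n) :=
    MulAction.orbitRel_apply.1 (Quotient.exact hcg.symm)
  obtain ⟨γ, hγ⟩ := h1
  have h2 : ((γ * c : SOevenC n) : SOevenC n ⧸ SOstar n) = g := hγ
  refine ⟨γ, γ.2, c, oboxG_subset_boxG n r hc, _, QuotientGroup.eq.1 h2, by group⟩

lemma trace_mul_conjTranspose_re {n : ℕ} (X : Mat2 n) :
    (X * Xᴴ).trace.re = ∑ i, ∑ j, ‖X i j‖ ^ 2 := by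
  simp only [Matrix.trace, Matrix.diag, Matrix.mul_apply, conjTranspose_apply, Complex.re_sum]
  refine Finset.sum_congr rfl fun i _ => Finset.sum_congr rfl fun j _ => ?_
  rw [Complex.star_def, Complex.mul_conj, Complex.ofReal_re, Complex.normSq_eq_norm_sq]

lemma norm_sq_le_trace_re {n : ℕ} (X : Mat2 n) (i j) : ‖X i j‖ ^ 2 ≤ (X * Xᴴ).trace.re := by
  rw [trace_mul_conjTranspose_re]
  exact (Finset.single_le_sum (f := fun j => ‖X i j‖ ^ 2) (fun _ _ => sq_nonneg _)
    (Finset.mem_univ j)).trans (Finset.single_le_sum (f := fun i => ∑ j, ‖X i j‖ ^ 2)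
      (fun _ _ => Finset.sum_nonneg fun _ _ => sq_nonneg _) (Finset.mem_univ i))

/-- An equivariant continuous family of positive Hermitian forms on `G/H`, bounded below by the
standard form over a given compact set. -/
lemma exists_equivariant_form {n : ℕ} (Γ : Subgroup (SOevenC n))
    [ProperlyDiscontinuousSMul Γ (SOevenC n ⧸ SOstar n)] {K : Set (SOevenC n ⧸ SOstar n)}
    (hK : IsCompact K) :
    ∃ b : SOevenC n ⧸ SOstar n → Mat2 n, Continuous b ∧
      (∀ (γ : Γ) q, b (γ • q) = gm (γ : SOevenC n) * b q * (gm (γ : SOevenC n))ᴴ) ∧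
      ∀ q ∈ K, ∀ X : Mat2 n, (X * Xᴴ).trace.re ≤ (X * b q * Xᴴ).trace.re := by
  obtain ⟨f, hf1, -, hfc, hf01⟩ :=
    exists_continuous_one_zero_of_isCompact hK isClosed_empty (Set.disjoint_empty K)
  let T := tsupport f
  let F : Γ → SOevenC n ⧸ SOstar n → Mat2 n := fun γ q =>
    f (γ⁻¹ • q) • (gm (γ : SOevenC n) * (gm (γ : SOevenC n))ᴴ)
  have hsupp : ∀ γ q, F γ q ≠ 0 → γ⁻¹ • q ∈ T := fun γ q h =>
    subset_tsupport _ fun h0 => h (by simp only [F, h0, zero_smul])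
  have hL : ∀ L : Set (SOevenC n ⧸ SOstar n), IsCompact L →
      {γ : Γ | ∃ q ∈ L, F γ q ≠ 0}.Finite := fun L hL => by
    refine (ProperlyDiscontinuousSMul.finite_disjoint_inter_image (Γ := Γ) (K := T) hfc hL).subset
      fun γ hγ => ?_
    obtain ⟨q, hq, hne⟩ := hγ
    exact ⟨q, ⟨_, hsupp γ q hne, smul_inv_smul γ q⟩, hq⟩
  have hfin : ∀ q, Function.HasFiniteSupport fun γ => F γ q := fun q =>
    (hL {q} isCompact_singleton).subset fun γ hγ => ⟨q, rfl, hγ⟩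
  refine ⟨fun q => ∑ᶠ γ, F γ q, ?_, ?_, ?_⟩
  · refine continuous_finsum (fun γ => ?_) fun q => ?_
    · exact (f.continuous.comp (continuous_const_smul γ⁻¹)).smul continuous_const
    · obtain ⟨L, hLc, hLq⟩ := exists_compact_mem_nhds q
      refine ⟨L, hLq, (hL L hLc).subset ?_⟩
      rintro γ ⟨x, hx, hxL⟩
      exact ⟨x, hxL, hx⟩
  · intro γ q
    let A := gm (γ : SOevenC n)
    let φ : Mat2 n →+ Mat2 n := (AddMonoidHom.mulRight Aᴴ).comp (AddMonoidHom.mulLeft A)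
    have hφ : ∀ X, φ X = A * X * Aᴴ := fun X => rfl
    change ∑ᶠ δ, F δ (γ • q) = A * (∑ᶠ δ, F δ q) * Aᴴ
    rw [← hφ, φ.map_finsum (hfin q), ← finsum_comp_equiv (Equiv.mulLeft γ)]
    refine finsum_congr fun δ => ?_
    rw [hφ]
    simp only [F, Equiv.coe_mulLeft, _root_.mul_inv_rev, mul_smul, inv_smul_smul, Subgroup.coe_mul,
      gm_mul, conjTranspose_mul, Matrix.mul_smul, Matrix.smul_mul, Matrix.mul_assoc, A]
  · intro q hq X
    let φ : Mat2 n →+ ℝ :=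
      { toFun := fun B => (X * B * Xᴴ).trace.re
        map_zero' := by simp
        map_add' := fun B C => by simp [mul_add, add_mul] }
    have hφ : ∀ B, φ B = (X * B * Xᴴ).trace.re := fun B => rfl
    rw [← hφ, φ.map_finsum (hfin q)]
    have hterm : ∀ γ, φ (F γ q) =
        f (γ⁻¹ • q) * ((X * gm (γ : SOevenC n)) * (X * gm (γ : SOevenC n))ᴴ).trace.re := by
      intro γ
      rw [hφ]
      simp only [F, Matrix.mul_smul, Matrix.smul_mul, trace_smul, Complex.smul_re, smul_eq_mul,
        conjTranspose_mul, Matrix.mul_assoc]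
    have h1 : φ (F 1 q) = (X * Xᴴ).trace.re := by
      rw [hterm, inv_one, one_smul, hf1 hq, Subgroup.coe_one, gm_one, mul_one, Pi.one_apply,
        one_mul]
    rw [← h1]
    refine single_le_finsum (f := fun γ => φ (F γ q)) 1 ?_ fun γ => ?_
    · refine Set.Finite.subset (hfin q) fun γ hγ h0 => hγ ?_
      change φ (F γ q) = 0
      rw [show F γ q = 0 from h0, map_zero]
    · rw [hterm, trace_mul_conjTranspose_re]
      exact mul_nonneg (hf01 _).1
        (Finset.sum_nonneg fun _ _ => Finset.sum_nonneg fun _ _ => sq_nonneg _)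

/-- The tangent direction `h⁻¹ h⁻* - h* h` attached to `h ∈ SO*(2n)`. -/
lemma conj_sub_relations {n : ℕ} {h : SOevenC n} (hh : h ∈ SOstar n) :
    let Y := gm h⁻¹ * (gm h⁻¹)ᴴ - (gm h)ᴴ * gm h
    Yᴴ = Y ∧ Yᵀ * Smat n = -(Smat n * Y) ∧ Y * Jnn n = -(Jnn n * Y) := by
  intro Y
  have hS := Smat_sq n
  have hJ := Jnn_sq n
  have cS : ∀ A : Mat2 n, Smat n * (Smat n * A) = A := fun A => by
    rw [← Matrix.mul_assoc, hS, one_mul]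
  have cJ : ∀ A : Mat2 n, Jnn n * (Jnn n * A) = A := fun A => by
    rw [← Matrix.mul_assoc, hJ, one_mul]
  have hSt : (Smat n)ᵀ = Smat n := by simp [Smat, fromBlocks_transpose]
  have hSh : (Smat n)ᴴ = Smat n := by simp [Smat, fromBlocks_conjTranspose]
  have invJ : ∀ {g : SOevenC n}, g ∈ SOstar n → gm g⁻¹ = Jnn n * ((gm g)ᴴ * Jnn n) := by
    intro g hg
    have h1 : Jnn n * ((gm g)ᴴ * Jnn n) * gm g = 1 := by
      rw [Matrix.mul_assoc, mem_SOstar.1 hg, hJ]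
    calc gm g⁻¹ = Jnn n * ((gm g)ᴴ * Jnn n) * gm g * gm g⁻¹ := by rw [h1, one_mul]
      _ = _ := by rw [Matrix.mul_assoc, gm_mul_inv, mul_one]
  refine ⟨?_, ?_, ?_⟩
  · simp only [Y, conjTranspose_sub, conjTranspose_mul, conjTranspose_conjTranspose]
  · have hM : gm h = Smat n * ((gm h⁻¹)ᵀ * Smat n) := by
      have := gm_inv h⁻¹
      rwa [inv_inv, Matrix.mul_assoc] at this
    have hMt : (gm h)ᵀ = Smat n * (gm h⁻¹ * Smat n) := by
      conv_lhs => rw [hM]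
      simp only [transpose_mul, transpose_transpose, hSt, Matrix.mul_assoc]
    have hPt : (gm h⁻¹)ᵀ = Smat n * (gm h * Smat n) := by
      rw [hM]; simp only [Matrix.mul_assoc, cS, hS, mul_one]
    have hMht : (gm h)ᴴᵀ = Smat n * ((gm h⁻¹)ᴴ * Smat n) := by
      have : (gm h)ᴴᵀ = (gm h)ᵀᴴ := rfl
      rw [this, hMt]
      simp only [conjTranspose_mul, hSh, Matrix.mul_assoc]
    have hPht : (gm h⁻¹)ᴴᵀ = Smat n * ((gm h)ᴴ * Smat n) := by
      have : (gm h⁻¹)ᴴᵀ = (gm h⁻¹)ᵀᴴ := rfl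
      rw [this, hPt]
      simp only [conjTranspose_mul, hSh, Matrix.mul_assoc]
    simp only [Y, transpose_sub, transpose_mul, hPt, hMt, hMht, hPht, sub_mul, mul_sub,
      Matrix.mul_assoc, cS, hS, mul_one]
    abel
  · have hP := invJ hh
    have hM : gm h = Jnn n * ((gm h⁻¹)ᴴ * Jnn n) := by
      have := invJ ((SOstar n).inv_mem hh)
      rwa [inv_inv] at this
    have hPh : (gm h⁻¹)ᴴ = Jnn n * (gm h * Jnn n) := by
      rw [hM]; simp only [Matrix.mul_assoc, cJ, hJ, mul_one]
    have hMh : (gm h)ᴴ = Jnn n * (gm h⁻¹ * Jnn n) := by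
      rw [hP]; simp only [Matrix.mul_assoc, cJ, hJ, mul_one]
    simp only [Y, hPh, hMh, sub_mul, mul_sub, Matrix.mul_assoc, cJ, hJ, mul_one]
    abel

lemma trace_conj_sub_mul {n : ℕ} {h : SOevenC n} (c : Mat2 n) :
    let P := gm h⁻¹
    let q := Pᴴ * P
    ((P * Pᴴ - (gm h)ᴴ * gm h) * (P * c * Pᴴ)).trace = (q * c * q).trace - c.trace := by
  intro P q
  have h1 : gm h * P = 1 := gm_mul_inv h
  have h2 : Pᴴ * (gm h)ᴴ = 1 := by rw [← conjTranspose_mul, h1, conjTranspose_one]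
  rw [sub_mul, trace_sub]
  congr 1
  · rw [Matrix.mul_assoc P, Matrix.trace_mul_comm P]
    simp only [q, Matrix.mul_assoc]
  · rw [← Matrix.mul_assoc, Matrix.trace_mul_comm]
    have : Pᴴ * ((gm h)ᴴ * gm h * (P * c)) = Pᴴ * (gm h)ᴴ * (gm h * P) * c := by
      simp only [Matrix.mul_assoc]
    rw [this, h1, h2, one_mul, one_mul]

/-- If `‖q Q‖² ≤ R` with `q = h⁻* h⁻¹` and `Q⁻¹` has bounded entries, then so does `h⁻¹`. -/
lemma norm_entry_le_of_trace_le {n : ℕ} {P Q C : Mat2 n} {R r : ℝ}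
    (hQC : Q * C = 1) (hC : ∀ i j, ‖C i j‖ ≤ r)
    (hX : ((Pᴴ * P * Q) * (Pᴴ * P * Q)ᴴ).trace.re ≤ R) (i j) :
    ‖P i j‖ ≤ √(∑ _i : Fin n ⊕ Fin n, ∑ _j : Fin n ⊕ Fin n, √R * r) := by
  refine Real.le_sqrt_of_sq_le ?_
  have hXe : ∀ i j, ‖(Pᴴ * P * Q) i j‖ ≤ √R := fun i j =>
    Real.le_sqrt_of_sq_le ((norm_sq_le_trace_re _ i j).trans hX)
  have hq : Pᴴ * P = (Pᴴ * P * Q) * C := by rw [Matrix.mul_assoc _ Q, hQC, mul_one]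
  refine (norm_sq_le_trace_re P i j).trans ?_
  rw [Matrix.trace_mul_comm]
  calc (Pᴴ * P).trace.re ≤ ‖(Pᴴ * P).trace‖ := Complex.re_le_norm _
    _ ≤ ∑ i, ‖(Pᴴ * P) i i‖ := norm_sum_le _ _
    _ ≤ _ := Finset.sum_le_sum fun i _ => by
      rw [hq, Matrix.mul_apply]
      refine (norm_sum_le _ _).trans (Finset.sum_le_sum fun j _ => ?_)
      rw [norm_mul]
      exact mul_le_mul (hXe i j) (hC j i) (norm_nonneg _) (Real.sqrt_nonneg _)

/-- Each element of `SO*(2n)` can be moved by some `k` in the maximal compact subgroup so that it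
decomposes with bounded factors. -/
lemma exists_bounded_decomposition {n : ℕ} (Γ : Subgroup (SOevenC n))
    [ProperlyDiscontinuousSMul Γ (SOevenC n ⧸ SOstar n)]
    [CompactSpace (MulAction.orbitRel.Quotient Γ (SOevenC n ⧸ SOstar n))] :
    ∃ r s : ℝ, ∀ g ∈ SOstar n, ∃ k : KSub n, ∃ γ ∈ Γ, ∃ c ∈ boxG n r, ∃ h ∈ SOstar n,
      h⁻¹ ∈ boxG n s ∧ g * kG k = γ * c * h := by
  obtain ⟨r, hr⟩ := exists_boxG_decomposition Γ
  have hmk : Continuous ((↑) : SOevenC n → SOevenC n ⧸ SOstar n) := QuotientGroup.continuous_mk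
  obtain ⟨b, hb, hbΓ, hbK⟩ := exists_equivariant_form Γ ((isCompact_boxG n r).image hmk)
  let ψ : SOevenC n → ℝ := fun c => (gm c⁻¹ * b c * (gm c⁻¹)ᴴ).trace.re
  have hψ : Continuous ψ := by
    have h1 : Continuous fun c : SOevenC n => gm c⁻¹ := (continuous_gm n).comp continuous_inv
    have h2 : Continuous fun c : SOevenC n => b c := hb.comp hmk
    exact Complex.continuous_re.comp ((h1.mul h2).mul h1.matrix_conjTranspose).matrix_trace
  obtain ⟨R, hR⟩ := (isCompact_boxG n r).bddAbove_image hψ.continuousOn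
  refine ⟨r, √(∑ _i : Fin n ⊕ Fin n, ∑ _j : Fin n ⊕ Fin n, √R * r), fun g _ => ?_⟩
  have hcont : Continuous fun k : KSub n =>
      gm g⁻¹ * b ((g * kG k : SOevenC n) : SOevenC n ⧸ SOstar n) * (gm g⁻¹)ᴴ :=
    (continuous_const.mul (hb.comp (hmk.comp (continuous_const.mul (continuous_kG n))))).mul
      continuous_const
  obtain ⟨k, hk⟩ := exists_trace_eq_zero hcont fun k l hkl => by
    have : ((g * kG k : SOevenC n) : SOevenC n ⧸ SOstar n) = (g * kG l : SOevenC n) := by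
      rw [QuotientGroup.eq]
      have h1 := kG_inv_mul_mem hkl
      have h2 : (g * kG k)⁻¹ * (g * kG l) = (kG k)⁻¹ * kG l := by group
      rwa [h2]
    rw [this]
  obtain ⟨γ, hγ, c, hc, h, hh, hgk⟩ := hr (g * kG k)
  refine ⟨k, γ, hγ, c, hc, h, hh, ?_, hgk⟩
  have hbq : b ((g * kG k : SOevenC n) : SOevenC n ⧸ SOstar n) = gm γ * b c * (gm γ)ᴴ := by
    rw [← hbΓ ⟨γ, hγ⟩ c, smul_quotient_mk, hgk]
    congr 1
    rw [QuotientGroup.eq]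
    have : (γ * c * h)⁻¹ * (γ * c) = h⁻¹ := by group
    exact this ▸ (SOstar n).inv_mem hh
  have hZ : gm (kG k)⁻¹ * gm g⁻¹ * gm γ = gm h⁻¹ * gm c⁻¹ := by
    rw [← gm_mul, ← gm_mul, ← gm_mul]
    congr 1
    have : (kG k)⁻¹ * g⁻¹ * γ = (g * kG k)⁻¹ * γ := by group
    rw [this, hgk]
    group
  have hN : (kmat k)ᴴ * (gm g⁻¹ * b ((g * kG k : SOevenC n) : SOevenC n ⧸ SOstar n) *
      (gm g⁻¹)ᴴ) * kmat k = gm h⁻¹ * (gm c⁻¹ * b c * (gm c⁻¹)ᴴ) * (gm h⁻¹)ᴴ := by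
    have e1 : gm h⁻¹ * (gm c⁻¹ * b c * (gm c⁻¹)ᴴ) * (gm h⁻¹)ᴴ =
        (gm h⁻¹ * gm c⁻¹) * b c * (gm h⁻¹ * gm c⁻¹)ᴴ := by
      simp only [conjTranspose_mul, Matrix.mul_assoc]
    rw [e1, ← hZ, hbq, gm_kG_inv]
    simp only [conjTranspose_mul, conjTranspose_conjTranspose, Matrix.mul_assoc]
  obtain ⟨hY1, hY2, hY3⟩ := conj_sub_relations hh
  have htr := hk _ hY1 hY2 hY3
  rw [hN, trace_conj_sub_mul, Complex.sub_re, sub_eq_zero] at htr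
  have hψR : (gm c⁻¹ * b c * (gm c⁻¹)ᴴ).trace.re ≤ R := hR ⟨c, hc, rfl⟩
  have hX := hbK c ⟨c, hc, rfl⟩ ((gm h⁻¹)ᴴ * gm h⁻¹ * gm c⁻¹)
  have hXX : ((gm h⁻¹)ᴴ * gm h⁻¹ * gm c⁻¹) * b c * ((gm h⁻¹)ᴴ * gm h⁻¹ * gm c⁻¹)ᴴ =
      (gm h⁻¹)ᴴ * gm h⁻¹ * (gm c⁻¹ * b c * (gm c⁻¹)ᴴ) * ((gm h⁻¹)ᴴ * gm h⁻¹) := by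
    simp only [conjTranspose_mul, conjTranspose_conjTranspose, Matrix.mul_assoc]
  rw [hXX, htr] at hX
  exact fun i j => norm_entry_le_of_trace_le (gm_inv_mul c) hc (hX.trans hψR) i j

lemma exists_SOstar_subset_boxG {n : ℕ} (Γ : Subgroup (SOevenC n))
    [ProperlyDiscontinuousSMul Γ (SOevenC n ⧸ SOstar n)]
    [CompactSpace (MulAction.orbitRel.Quotient Γ (SOevenC n ⧸ SOstar n))] :
    ∃ m : ℕ, (SOstar n : Set (SOevenC n)) ⊆ boxG n m := by
  obtain ⟨r, s, hrs⟩ := exists_bounded_decomposition Γ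
  let E : Set (SOevenC n) :=
    (fun p : SOevenC n × SOevenC n × KSub n => p.1 * p.2.1⁻¹ * (kG p.2.2)⁻¹) ''
      (boxG n r ×ˢ boxG n s ×ˢ Set.univ)
  have hE : IsCompact E := by
    refine ((isCompact_boxG n r).prod ((isCompact_boxG n s).prod isCompact_univ)).image ?_
    have := continuous_kG n
    fun_prop
  have hfin := ProperlyDiscontinuousSMul.finite_disjoint_inter_image (Γ := Γ)
    (hE.image (f := ((↑) : SOevenC n → SOevenC n ⧸ SOstar n)) QuotientGroup.continuous_mk)
    (isCompact_singleton (x := ((1 : SOevenC n) : SOevenC n ⧸ SOstar n)))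
  obtain ⟨m, hm⟩ := exists_subset_boxG (hfin.isCompact_biUnion fun γ _ =>
    hE.image (continuous_const_mul (γ : SOevenC n)))
  refine ⟨m, fun g hg => hm ?_⟩
  obtain ⟨k, γ, hγ, c, hc, h, hh, hhs, hgk⟩ := hrs g hg
  have hmem : c * h * (kG k)⁻¹ ∈ E := ⟨(c, h⁻¹, k), ⟨hc, hhs, trivial⟩, by simp only [inv_inv]⟩
  have hge : γ * (c * h * (kG k)⁻¹) = g := by
    have : γ * (c * h * (kG k)⁻¹) = γ * c * h * (kG k)⁻¹ := by group
    rw [this, ← hgk]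
    group
  refine Set.mem_biUnion (x := (⟨γ, hγ⟩ : Γ)) ?_ ⟨_, hmem, hge⟩
  refine ⟨(g : SOevenC n ⧸ SOstar n), ⟨_, ⟨_, hmem, rfl⟩, ?_⟩, ?_⟩
  · exact congrArg _ hge
  · rw [Set.mem_singleton_iff, QuotientGroup.eq, mul_one]
    exact (SOstar n).inv_mem hg

end Helpers

/-- **No compact Clifford–Klein forms for `SO(2n,ℂ)/SO*(2n)`.**
For `n ≥ 2`, there is no discrete subgroup `Γ` of `G = SO(2n,ℂ)` acting properly
discontinuously and cocompactly on the homogeneous space `G/H`, where `H = SO*(2n)`. -/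
theorem no_compact_CliffordKlein_form_SOC_SOstar (n : ℕ) (hn : 2 ≤ n) :
    ¬ ∃ Γ : Subgroup ↥(SOevenC n), DiscreteTopology ↥Γ ∧
      ProperlyDiscontinuousSMul ↥Γ (↥(SOevenC n) ⧸ SOstar n) ∧
      CompactSpace (MulAction.orbitRel.Quotient ↥Γ (↥(SOevenC n) ⧸ SOstar n)) := by
  rintro ⟨Γ, -, _, _⟩
  obtain ⟨m, hm⟩ := exists_SOstar_subset_boxG Γ
  obtain ⟨g, hg, i, j, hij⟩ := exists_mem_SOstar_large hn m
  exact (hm hg i j).not_gt hij
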